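/- Counting formula for well shaped sets: let p be a prime, let m, n be positive integers, and let G_1, …, G_n ∈ F_p[X_1, …, X_m] be degree 2 independent over F_p with total degrees at most d. Then there is a constant c depending only on m, n, d and C such that for every well shaped set Ω ⊆ 𝕋_m with constant C and every box Π = [α_1, β_1) × ⋯ × [α_n, β_n) ⊆ 𝕋_n, the number N(Ω; Π) of integer vectors x ∈ {0, …, p−1}^m with x/p ∈ Ω and ({G_1(x)/p}, …, {G_n(x)/p}) ∈ Π satisfies |N(Ω; Π) − λ(Π) μ(Ω) p^m| ≤ c · p^{m−1/2} (log p)^{n+2}. -/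

import Mathlib

open MeasureTheory

noncomputable section

abbrev Torus (m : ℕ) : Type := Fin m → AddCircle (1 : ℝ)

noncomputable def tmeas {m : ℕ} (Ω : Set (Torus m)) : ℝ := (volume Ω).toReal

noncomputable def torusDist {m : ℕ} (u w : Torus m) : ℝ :=
  Real.sqrt (∑ i, dist (u i) (w i) ^ 2)

noncomputable def torusDistSet {m : ℕ} (u : Torus m) (Ω : Set (Torus m)) : ℝ :=
  ⨅ w : Ω, torusDist u (w : Torus m)

def outerShell {m : ℕ} (Ω : Set (Torus m)) (ε : ℝ) : Set (Torus m) :=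
  {u | u ∉ Ω ∧ torusDistSet u Ω < ε}

def innerShell {m : ℕ} (Ω : Set (Torus m)) (ε : ℝ) : Set (Torus m) :=
  {u | u ∈ Ω ∧ torusDistSet u Ωᶜ < ε}

def IsWellShaped {m : ℕ} (Ω : Set (Torus m)) (C : ℝ) : Prop :=
  ∀ ε : ℝ, 0 < ε →
    tmeas (outerShell Ω ε) ≤ C * ε ∧ tmeas (innerShell Ω ε) ≤ C * ε

def IsVeryWellShaped {m : ℕ} (Ω : Set (Torus m)) (C : ℝ) : Prop :=
  ∀ ε : ℝ, 0 < ε →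
    tmeas (outerShell Ω ε) ≤ C * (tmeas Ω ^ (1 - 1 / (m : ℝ)) * ε + ε ^ m) ∧
    tmeas (innerShell Ω ε) ≤ C * (tmeas Ω ^ (1 - 1 / (m : ℝ)) * ε + ε ^ m)

noncomputable def discrepancy {ι : Type*} {n : ℕ} (s : Set ι) (ξ : ι → Fin n → ℝ) : ℝ :=
  if s.ncard = 0 then 1
  else
    ⨆ B : {B : (Fin n → ℝ) × (Fin n → ℝ) // ∀ j, 0 ≤ B.1 j ∧ B.1 j ≤ B.2 j ∧ B.2 j ≤ 1},
      |((s ∩ {k | ∀ j, B.val.1 j ≤ ξ k j ∧ ξ k j < B.val.2 j}).ncard : ℝ) / (s.ncard : ℝ)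
        - ∏ j, (B.val.2 j - B.val.1 j)|

noncomputable def torusPt (p : ℕ) {m : ℕ} (x : Fin m → Fin p) : Torus m :=
  fun i => ((((x i : ℕ) : ℝ) / (p : ℝ) : ℝ) : AddCircle (1 : ℝ))

noncomputable def fracPt {p m n : ℕ} (G : Fin n → MvPolynomial (Fin m) (ZMod p))
    (x : Fin m → ℤ) : Fin n → ℝ :=
  fun j => ((MvPolynomial.eval (fun i => ((x i : ℤ) : ZMod p)) (G j)).val : ℝ) / (p : ℝ)

def Degree2Independent {p m n : ℕ} (G : Fin n → MvPolynomial (Fin m) (ZMod p)) : Prop :=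
  ∀ a : Fin n → ZMod p, a ≠ 0 → 2 ≤ (∑ j, a j • G j).totalDegree

def torusIcc (a b : ℝ) : Set (AddCircle (1 : ℝ)) :=
  (fun r : ℝ => (r : AddCircle (1 : ℝ))) '' Set.Icc a b

def gridCube {m : ℕ} (γ : Fin m → ℝ) (k : ℕ) (u : Fin m → ℤ) : Set (Torus m) :=
  {t | ∀ i, t i ∈ torusIcc (γ i + (u i : ℝ) / k) (γ i + ((u i : ℝ) + 1) / k)}

def torusCube {m : ℕ} (γ : Fin m → ℝ) (s : ℝ) : Set (Torus m) :=
  {t | ∀ i, t i ∈ torusIcc (γ i) (γ i + s)}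

def cubesIn {m : ℕ} (Ω : Set (Torus m)) (γ : Fin m → ℝ) (k : ℕ) : Set (Set (Torus m)) :=
  {Γ | (∃ u : Fin m → ℤ, Γ = gridCube γ k u) ∧ Γ ⊆ Ω}

def dyadicB {m : ℕ} (Ω : Set (Torus m)) (γ : Fin m → ℝ) (i : ℕ) : Set (Set (Torus m)) :=
  if i = 1 then cubesIn Ω γ 2
  else {Γ | Γ ∈ cubesIn Ω γ (2 ^ i) ∧ ∀ Γ' ∈ cubesIn Ω γ (2 ^ (i - 1)), ¬ Γ ⊆ Γ'}

def polySolutions (p : ℕ) {m n : ℕ} (F : Fin n → MvPolynomial (Fin m) ℤ) :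
    Set (Fin m → Fin p) :=
  {x | ∀ j, ((MvPolynomial.eval (fun i => ((x i : ℕ) : ℤ)) (F j) : ℤ) : ZMod p) = 0}

noncomputable def Tcount (p : ℕ) {m n : ℕ} (F : Fin n → MvPolynomial (Fin m) ℤ)
    (S : Set (Torus m)) : ℕ :=
  (polySolutions p F ∩ {x | torusPt p x ∈ S}).ncard

end


namespace CWS
open Polynomial

lemma exists_lin_rel {K : Type*} [Field K] {ι : Type*} [Fintype ι] (v : ι → K[X]) (N : ℕ)
    (hN : N < Fintype.card ι) (hv : ∀ i, (v i).natDegree < N) :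
    ∃ c : ι → K, c ≠ 0 ∧ ∑ i, c i • v i = 0 := by
  classical
  let Φ : (ι → K) →ₗ[K] (Fin N → K) :=
    (LinearMap.pi fun j : Fin N => Polynomial.lcoeff K (j : ℕ)) ∘ₗ (Fintype.linearCombination K v)
  have h := LinearMap.ker_ne_bot_of_finrank_lt (f := Φ) (by simpa using hN)
  obtain ⟨c, hc, hc0⟩ := (Submodule.ne_bot_iff _).1 h
  refine ⟨c, hc0, ?_⟩
  have hc' : ∀ j : Fin N, (∑ i, c i • v i).coeff j = 0 := by
    intro j
    have := congrFun (LinearMap.mem_ker.1 hc) j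
    simpa [Φ, Fintype.linearCombination_apply] using this
  ext j
  by_cases hj : j < N
  · simpa using hc' ⟨j, hj⟩
  · simp only [coeff_zero, finsetSum_coeff, coeff_smul, smul_eq_mul]
    refine Finset.sum_eq_zero fun i _ => ?_
    rw [coeff_eq_zero_of_natDegree_lt (lt_of_lt_of_le (hv i) (not_lt.1 hj)), mul_zero]

/-- the half trace polynomial -/
noncomputable def gpol {K : Type*} [Field K] (p r : ℕ) (f : K[X]) : K[X] :=
  ∑ j ∈ Finset.range r, f ^ p ^ j

lemma gpol_natDegree {K : Type*} [Field K] (p r : ℕ) (hp : 2 ≤ p) (f : K[X])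
    (hf : 1 ≤ f.natDegree) : (gpol p (r+1) f).natDegree = f.natDegree * p ^ r := by
  induction r with
  | zero => simp [gpol]
  | succ r ih =>
    rw [gpol, Finset.sum_range_succ, ← gpol, add_comm]
    have h1 : (f ^ p ^ (r+1)).natDegree = f.natDegree * p ^ (r+1) := by
      rw [natDegree_pow, mul_comm]
    rw [natDegree_add_eq_left_of_natDegree_lt, h1]
    rw [ih, h1]
    have : p ^ r < p ^ (r+1) := Nat.pow_lt_pow_right (by omega) (by omega)
    exact Nat.mul_lt_mul_of_pos_left this (by omega)

lemma stepanov_indep {K : Type*} [Field K] (A B p D : ℕ) (hp : p.Prime) (hD : Nat.Coprime D p)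
    (hA : 0 < A) (g : K[X]) (hg : g.natDegree = D * A) (hg0 : g ≠ 0)
    (c : Fin A × Fin B × Fin p → K) (hc : c ≠ 0) :
    ∑ i, C (c i) * (X ^ (i.1.1 + A * p * i.2.1.1) * g ^ i.2.2.1) ≠ 0 := by
  intro h
  have hdeg : ∀ i, c i ≠ 0 → (C (c i) * (X ^ (i.1.1 + A * p * i.2.1.1) * g ^ i.2.2.1)).degree
      = ((i.1.1 + A * (p * i.2.1.1 + D * i.2.2.1) : ℕ) : WithBot ℕ) := by
    intro i hi
    rw [degree_C_mul hi, degree_eq_natDegree (mul_ne_zero (pow_ne_zero _ X_ne_zero) (pow_ne_zero _ hg0)),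
      natDegree_mul (pow_ne_zero _ X_ne_zero) (pow_ne_zero _ hg0), natDegree_X_pow, natDegree_pow, hg]
    congr 1; ring
  have hinj : ∀ i j : Fin A × Fin B × Fin p, i.1.1 + A * (p * i.2.1.1 + D * i.2.2.1) =
      j.1.1 + A * (p * j.2.1.1 + D * j.2.2.1) → i = j := by
    rintro ⟨a, b, e⟩ ⟨a', b', e'⟩ hij
    simp only at hij
    have h1 : a.1 = a'.1 := by
      have := congrArg (· % A) hij
      simpa [Nat.add_mul_mod_self_left, Nat.mod_eq_of_lt a.2, Nat.mod_eq_of_lt a'.2] using this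
    have h2 : p * b.1 + D * e.1 = p * b'.1 + D * e'.1 := by
      rw [h1] at hij
      exact Nat.eq_of_mul_eq_mul_left hA (Nat.add_left_cancel hij)
    have h3 : D * e.1 ≡ D * e'.1 [MOD p] := by
      have := congrArg (· % p) h2
      simpa [Nat.ModEq, Nat.add_mod] using this
    have h4 : e.1 = e'.1 := by
      have h5 : e.1 ≡ e'.1 [MOD p] := Nat.ModEq.cancel_left_of_coprime (by simpa [Nat.coprime_comm] using hD) h3
      simpa [Nat.ModEq, Nat.mod_eq_of_lt e.2, Nat.mod_eq_of_lt e'.2] using h5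
    have h6 : b.1 = b'.1 := by
      rw [h4] at h2
      exact Nat.eq_of_mul_eq_mul_left hp.pos (Nat.add_right_cancel h2)
    ext <;> assumption
  have hs := degree_sum_eq_of_disjoint
    (fun i : Fin A × Fin B × Fin p => C (c i) * (X ^ (i.1.1 + A * p * i.2.1.1) * g ^ i.2.2.1))
    Finset.univ (by
      rintro i ⟨-, hi⟩ j ⟨-, hj⟩ hij
      have hi' : c i ≠ 0 := by rintro h0; simp [h0] at hi
      have hj' : c j ≠ 0 := by rintro h0; simp [h0] at hj
      simp only [Function.onFun, Function.comp, hdeg i hi', hdeg j hj']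
      intro hh
      exact hij (hinj i j (by exact_mod_cast hh)))
  rw [h, degree_zero] at hs
  obtain ⟨i, hi⟩ := Function.ne_iff.1 hc
  have h1 := Finset.le_sup (f := fun i : Fin A × Fin B × Fin p => (C (c i) * (X ^ (i.1.1 + A * p * i.2.1.1) * g ^ i.2.2.1)).degree) (Finset.mem_univ i)
  rw [← hs] at h1
  simp only [hdeg i hi] at h1
  exact WithBot.coe_ne_bot (le_bot_iff.1 h1)

lemma stepanov {K : Type*} [Field K] [IsAlgClosed K] (p : ℕ) [hp : Fact p.Prime] [CharP K p]
    (f : K[X]) (D r : ℕ) (hf : f.natDegree = D) (hD1 : 1 ≤ D) (hD : Nat.Coprime D p)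
    (hr : D + 2 ≤ p ^ r) (t : K) (Z : Finset K)
    (hZ : ∀ x ∈ Z, x ^ p ^ (2 * (r+1)) = x ∧
      ∑ j ∈ Finset.range (2 * (r+1)), f.eval x ^ p ^ j = t) :
    Z.card ≤ p ^ (2 * (r+1) - 1) + (2 * D + 1) * p ^ (r+1) := by
  classical
  have : ExpChar K p := ExpChar.prime hp.out
  have hp2 : 2 ≤ p := hp.out.two_le
  set A := p ^ r with hA
  set B := A + D + 1 with hB
  set g := gpol p (r+1) f with hg
  have hgd : g.natDegree = D * A := by rw [hg, gpol_natDegree p r hp2 f (by omega), hf]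
  have hA0 : 0 < A := by omega
  have hg0 : g ≠ 0 := by
    rintro h0; rw [h0, natDegree_zero] at hgd
    have : 0 < D * A := Nat.mul_pos (by omega) hA0
    omega
  have hgd' : (C t - g).natDegree ≤ D * A := by
    refine (natDegree_sub_le _ _).trans ?_
    simp [hgd]
  have hQ : p ^ (r+1) = A * p := by rw [pow_succ]
  let v : Fin A × Fin B × Fin p → K[X] := fun i =>
    X ^ (A * p * i.1.1 + i.2.1.1) * (C t - g) ^ i.2.2.1
  have hvd : ∀ i, (v i).natDegree < A * p * A + B + D * (A * p) := by
    rintro ⟨a, b, e⟩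
    have h1 : (v (a,b,e)).natDegree ≤ (A * p * a.1 + b.1) + e.1 * (D * A) := by
      refine natDegree_mul_le.trans ?_
      gcongr
      · simp
      · exact natDegree_pow_le.trans (Nat.mul_le_mul_left _ hgd')
    have h2 : A * p * a.1 ≤ A * p * A := Nat.mul_le_mul_left _ a.2.le
    have h3 : e.1 * (D * A) ≤ p * (D * A) := Nat.mul_le_mul_right _ e.2.le
    have h4 := b.2
    have h5 : p * (D * A) = D * (A * p) := by ring
    omega
  obtain ⟨c, hc0, hc⟩ := exists_lin_rel v (A * p * A + B + D * (A * p)) (by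
    simp only [Fintype.card_prod, Fintype.card_fin]
    have : A * (B * p) = A * p * A + D * (A * p) + A * p := by rw [hB]; ring
    have h2 : A * 2 ≤ A * p := Nat.mul_le_mul_left _ hp2
    omega) hvd
  have hroot : ∀ i, ∃ z : K, z ^ (p ^ (r+1)) = c i := fun i =>
    IsAlgClosed.exists_pow_nat_eq _ (pow_pos (by omega) _)
  choose c' hc' using hroot
  have hc'0 : c' ≠ 0 := by
    rintro h0
    apply hc0
    funext i
    rw [← hc' i, h0]
    simp [hp.out.ne_zero]
  set R : K[X] := ∑ i, C (c' i) * (X ^ (i.1.1 + A * p * i.2.1.1) * g ^ i.2.2.1) with hR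
  have hR0 : R ≠ 0 := stepanov_indep A B p D hp.out hD hA0 g hgd hg0 c' hc'0
  have hRd : R.natDegree ≤ p ^ (2 * (r+1) - 1) + (2 * D + 1) * p ^ (r+1) := by
    rw [hR]
    refine natDegree_sum_le_of_forall_le _ _ ?_
    rintro ⟨a, b, e⟩ -
    refine (natDegree_C_mul_le _ _).trans (natDegree_mul_le.trans ?_)
    have h1 : (g ^ e.1).natDegree ≤ e.1 * (D * A) := by
      refine natDegree_pow_le.trans (by rw [hgd])
    have h3 : e.1 * (D * A) ≤ p * (D * A) := Nat.mul_le_mul_right _ e.2.le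
    have h4 : A * p * b.1 ≤ A * p * (A + D) := Nat.mul_le_mul_left _ (by have := b.2; omega)
    have h5 : a.1 ≤ A * p := a.2.le.trans (Nat.le_mul_of_pos_right _ (by omega))
    have h6 : p ^ (2 * (r+1) - 1) = A * p * A := by
      rw [hA, ← pow_succ, ← pow_add]; congr 1; omega
    rw [h6, hQ]
    simp only [natDegree_X_pow]
    have h7 : A * p * (A + D) = A * p * A + D * (A * p) := by ring
    have h8 : p * (D * A) = D * (A * p) := by ring
    have h9 : (2 * D + 1) * (A * p) = 2 * (D * (A * p)) + A * p := by ring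
    omega
  have hsub : Z ⊆ R.roots.toFinset := by
    intro x hx
    obtain ⟨hx1, hx2⟩ := hZ x hx
    rw [Multiset.mem_toFinset, mem_roots hR0, IsRoot.def]
    have hw : (g.eval x) ^ p ^ (r+1) = t - g.eval x := by
      rw [eq_sub_iff_add_eq, ← hx2, hg, gpol, eval_finsetSum, sum_pow_char_pow, two_mul,
        Finset.sum_range_add _ (r+1) (r+1), add_comm]
      congr 1
      · simp
      · refine Finset.sum_congr rfl fun j _ => ?_
        rw [eval_pow, ← pow_mul, ← pow_add, add_comm j]
    have hpow : (R.eval x) ^ p ^ (r+1) = 0 := by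
      have h1 := congrArg (eval x) hc
      rw [eval_zero, eval_finsetSum] at h1
      rw [hR, eval_finsetSum, sum_pow_char_pow, ← h1]
      refine Finset.sum_congr rfl ?_
      rintro ⟨a, b, e⟩ -
      simp only [v, eval_mul, eval_pow, eval_C, eval_X, eval_smul, eval_sub, smul_eq_mul]
      rw [mul_pow, hc', mul_pow, ← pow_mul (g.eval x), mul_comm e.1, pow_mul, hw]
      congr 2
      have hxx : x ^ (A * p * (A * p)) = x := by
        rw [← hQ, ← pow_add, ← two_mul]; exact hx1
      rw [← pow_mul, hQ, add_mul, pow_add,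
        show A * p * b.1 * (A * p) = A * p * (A * p) * b.1 by ring, pow_mul x _ b.1, hxx, pow_add, mul_comm a.1]
    exact pow_eq_zero_iff (pow_pos (by omega : 0 < p) _).ne' |>.1 hpow
  calc Z.card ≤ R.roots.toFinset.card := Finset.card_le_card hsub
    _ ≤ R.roots.card := Multiset.toFinset_card_le _
    _ ≤ R.natDegree := card_roots' R
    _ ≤ _ := hRd
end CWS


namespace CWS
open Polynomial
open scoped Classical

section B1
set_option linter.unusedSectionVars false
set_option linter.unusedVariables false
variable {K : Type*} [Field K] [IsAlgClosed K] (p : ℕ) [hp : Fact p.Prime] [CharP K p]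

instance expCharInst : ExpChar K p := ExpChar.prime hp.out

variable (K) in
noncomputable def Fk (k : ℕ) : Finset K := (X ^ p ^ k - X : K[X]).roots.toFinset

lemma mem_Fk {k : ℕ} (hk : k ≠ 0) (x : K) : x ∈ Fk K p k ↔ x ^ p ^ k = x := by
  rw [Fk, Multiset.mem_toFinset,
    mem_roots (FiniteField.X_pow_card_pow_sub_X_ne_zero K hk hp.out.one_lt)]
  simp [sub_eq_zero]

lemma card_Fk {k : ℕ} (hk : k ≠ 0) : (Fk K p k).card = p ^ k := by
  rw [Fk, Multiset.toFinset_card_of_nodup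
    (nodup_roots (galois_poly_separable p _ (dvd_pow_self p hk))),
    ← (IsAlgClosed.splits _).natDegree_eq_card_roots,
    FiniteField.X_pow_card_pow_sub_X_natDegree_eq K hk hp.out.one_lt]

lemma fixed_iff [Algebra (ZMod p) K] (x : K) : x ^ p = x ↔ ∃ a : ZMod p, algebraMap (ZMod p) K a = x := by
  have hinj := (algebraMap (ZMod p) K).injective
  have h1 : Finset.univ.image (algebraMap (ZMod p) K) = Fk K p 1 := by
    apply Finset.eq_of_subset_of_card_le
    · intro y hy
      obtain ⟨a, -, rfl⟩ := Finset.mem_image.1 hy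
      rw [mem_Fk p one_ne_zero, pow_one, ← map_pow, ZMod.pow_card]
    · rw [card_Fk p one_ne_zero, Finset.card_image_of_injective _ hinj, Finset.card_univ, ZMod.card, pow_one]
  have h2 := mem_Fk p one_ne_zero x
  rw [pow_one, ← h1] at h2
  rw [← h2]; simp

variable (K) in
noncomputable def Mn [Algebra (ZMod p) K] (n : ℕ) : Finset K[X] :=
  Finset.univ.image (fun a : Fin n → ZMod p =>
    X ^ n + ∑ i : Fin n, C (algebraMap (ZMod p) K (a i)) * X ^ (i : ℕ))

lemma mem_Mn [Algebra (ZMod p) K] {n : ℕ} (h : K[X]) :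
    h ∈ Mn K p n ↔ h.Monic ∧ h.natDegree = n ∧ h.map (frobenius K p) = h := by
  constructor
  · intro hh
    obtain ⟨a, -, rfl⟩ := Finset.mem_image.1 hh
    have hd : (∑ i : Fin n, C (algebraMap (ZMod p) K (a i)) * X ^ (i : ℕ)).degree < (n : WithBot ℕ) := by
      rw [degree_lt_iff_coeff_zero]
      intro m hm
      rw [finsetSum_coeff]
      refine Finset.sum_eq_zero fun i _ => ?_
      rw [coeff_C_mul, coeff_X_pow, if_neg (by have := i.2; omega), mul_zero]
    have hm := monic_X_pow_add hd
    refine ⟨hm, ?_, ?_⟩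
    · apply natDegree_eq_of_degree_eq_some
      rw [degree_add_eq_left_of_degree_lt (by simpa using hd), degree_X_pow]
    · simp [Polynomial.map_sum, frobenius_def, ← map_pow, ZMod.pow_card]
  · rintro ⟨hm, hd, hfix⟩
    have hc : ∀ i, ∃ a : ZMod p, algebraMap (ZMod p) K a = h.coeff i := by
      intro i
      rw [← fixed_iff]
      conv_rhs => rw [← hfix]
      rw [coeff_map, frobenius_def]
    choose a ha using hc
    refine Finset.mem_image.2 ⟨fun i => a i, Finset.mem_univ _, ?_⟩
    simp only [ha]
    rw [Fin.sum_univ_eq_sum_range (fun i => C (h.coeff i) * X ^ i), ← hd]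
    exact hm.as_sum.symm

noncomputable def chi (k : ℕ) (x : K) : K[X] := ∏ i ∈ Finset.range k, (X - C (x ^ p ^ i))

lemma chi_monic (k : ℕ) (x : K) : (chi p k x).Monic := monic_prod_of_monic _ _ fun i _ => monic_X_sub_C _

lemma chi_natDegree (k : ℕ) (x : K) : (chi p k x).natDegree = k := by
  rw [chi, natDegree_prod_of_monic _ _ fun i _ => monic_X_sub_C _]
  simp only [natDegree_X_sub_C]
  simp

lemma chi_map (k : ℕ) (x : K) (hx : x ^ p ^ k = x) : (chi p k x).map (frobenius K p) = chi p k x := by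
  rw [chi, Polynomial.map_prod]
  simp only [Polynomial.map_sub, map_X, map_C, frobenius_def, ← pow_mul, ← pow_succ]
  cases k with
  | zero => simp
  | succ k => rw [Finset.prod_range_succ, hx, Finset.prod_range_succ', pow_zero, pow_one]

lemma chi_roots (k : ℕ) (x : K) : (chi p k x).roots = (Finset.range k).val.map (fun i => x ^ p ^ i) := by
  conv_rhs => rw [← roots_multiset_prod_X_sub_C ((Finset.range k).val.map (fun i => x ^ p ^ i))]
  rw [Multiset.map_map]; rfl

lemma chi_mul_period (δ j : ℕ) (x : K) (hx : x ^ p ^ δ = x) : chi p (δ * j) x = chi p δ x ^ j := by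
  have hx' : ∀ j, x ^ p ^ (δ * j) = x := by
    intro j
    induction j with
    | zero => simp
    | succ j ih => rw [mul_add, mul_one, pow_add, pow_mul, ih, hx]
  induction j with
  | zero => simp [chi]
  | succ j ih =>
    rw [mul_add, mul_one, chi, Finset.prod_range_add, ← chi, ih, pow_succ]
    congr 1
    refine Finset.prod_congr rfl fun i _ => ?_
    rw [pow_add, pow_mul, hx']

lemma mult_frob (h : K[X]) (hh : h.map (frobenius K p) = h) (x : K) (i : ℕ) :
    h.rootMultiplicity (x ^ p ^ i) = h.rootMultiplicity x := by
  induction i with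
  | zero => simp
  | succ i ih =>
    rw [← ih, eq_rootMultiplicity_map (frobenius K p).injective (x ^ p ^ i), hh, frobenius_def,
      ← pow_mul, ← pow_succ]

lemma period_pos (h : K[X]) (h0 : h ≠ 0) (hh : h.map (frobenius K p) = h) (x : K) (hx : h.IsRoot x) :
    ∃ δ, 0 < δ ∧ x ^ p ^ δ = x ∧ (∀ k, x ^ p ^ k = x → δ ∣ k) ∧
      (∀ i j, i < δ → j < δ → x ^ p ^ i = x ^ p ^ j → i = j) := by
  have hmap : ∀ i, x ^ p ^ i ∈ h.roots.toFinset := by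
    intro i
    rw [Multiset.mem_toFinset, mem_roots h0, ← rootMultiplicity_pos h0, mult_frob p h hh,
      rootMultiplicity_pos h0]
    exact hx
  have hper : x ∈ Function.periodicPts (frobenius K p) := by
    obtain ⟨i, j, hij, he⟩ : ∃ i j : ℕ, i < j ∧ x ^ p ^ i = x ^ p ^ j := by
      obtain ⟨i, j, hne, he⟩ := Finite.exists_ne_map_eq_of_infinite
        (fun i : ℕ => (⟨x ^ p ^ i, hmap i⟩ : h.roots.toFinset))
      simp only [Subtype.mk.injEq] at he
      rcases lt_or_gt_of_ne hne with hl | hl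
      · exact ⟨i, j, hl, he⟩
      · exact ⟨j, i, hl, he.symm⟩
    refine ⟨j - i, by omega, ?_⟩
    rw [Function.IsPeriodicPt, Function.IsFixedPt, iterate_frobenius]
    have h2 : (frobenius K p)^[i] (x ^ p ^ (j - i)) = (frobenius K p)^[i] x := by
      rw [iterate_frobenius, iterate_frobenius, ← pow_mul, ← pow_add, Nat.sub_add_cancel hij.le, he]
    exact (Function.Injective.iterate (frobenius K p).injective i) h2
  refine ⟨Function.minimalPeriod (frobenius K p) x, Function.minimalPeriod_pos_of_mem_periodicPts hper,
    ?_, ?_, ?_⟩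
  · rw [← iterate_frobenius]
    exact Function.isPeriodicPt_minimalPeriod _ _
  · intro k hk
    apply Function.IsPeriodicPt.minimalPeriod_dvd
    rw [Function.IsPeriodicPt, Function.IsFixedPt, iterate_frobenius, hk]
  · intro i j hi hj he
    refine Function.iterate_injOn_Iio_minimalPeriod hi hj ?_
    simpa [iterate_frobenius] using he

lemma count_one (h : K[X]) (n : ℕ) (hd : h.natDegree = n) (h0 : h ≠ 0) (hh : h.map (frobenius K p) = h)
    (x : K) (hx : h.IsRoot x) :
    ((Finset.Icc 1 n).filter (fun k => x ^ p ^ k = x ∧ chi p k x ∣ h)).card = h.rootMultiplicity x := by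
  obtain ⟨δ, hδ, hδx, hδd, hδi⟩ := period_pos p h h0 hh x hx
  have key : ∀ j, chi p (δ * j) x ∣ h ↔ j ≤ h.rootMultiplicity x := by
    intro j
    rw [chi_mul_period p δ j x hδx]
    constructor
    · intro hj
      rw [le_rootMultiplicity_iff h0]
      refine (pow_dvd_pow_of_dvd ?_ j).trans hj
      have := Finset.dvd_prod_of_mem (fun i => (X - C (x ^ p ^ i))) (Finset.mem_range.2 hδ)
      simpa [chi] using this
    · intro hj
      rw [chi, ← Finset.prod_pow]
      refine Finset.prod_dvd_of_coprime ?_ ?_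
      · intro i hi j hj hij
        refine IsCoprime.pow (isCoprime_X_sub_C_of_isUnit_sub (sub_ne_zero.2 ?_).isUnit)
        intro he
        exact hij (hδi i j (Finset.mem_range.1 hi) (Finset.mem_range.1 hj) he)
      · intro i _
        rw [← le_rootMultiplicity_iff h0, mult_frob p h hh]
        exact hj
  have hset : (Finset.Icc 1 n).filter (fun k => x ^ p ^ k = x ∧ chi p k x ∣ h)
      = (Finset.Icc 1 (h.rootMultiplicity x)).image (fun j => δ * j) := by
    ext k
    simp only [Finset.mem_filter, Finset.mem_Icc, Finset.mem_image]
    constructor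
    · rintro ⟨⟨h1, h2⟩, h3, h4⟩
      obtain ⟨j, rfl⟩ := hδd k h3
      exact ⟨j, ⟨Nat.pos_of_mul_pos_left h1, (key j).1 h4⟩, rfl⟩
    · rintro ⟨j, ⟨h1, h2⟩, rfl⟩
      have h3 := (key j).2 h2
      refine ⟨⟨Nat.mul_pos hδ h1, ?_⟩, ?_, h3⟩
      · rw [← hd, ← chi_natDegree p (δ * j) x]
        exact natDegree_le_of_dvd h3 h0
      · have : ∀ j, x ^ p ^ (δ * j) = x := by
          intro j
          induction j with
          | zero => simp
          | succ j ih => rw [mul_add, mul_one, pow_add, pow_mul, ih, hδx]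
        exact this j
  rw [hset, Finset.card_image_of_injective _ (fun a b hab => Nat.eq_of_mul_eq_mul_left hδ hab)]
  simp

lemma count_all (h : K[X]) (n : ℕ) (hd : h.natDegree = n) (h0 : h ≠ 0) (hh : h.map (frobenius K p) = h) :
    ∑ k ∈ Finset.Icc 1 n, ((Fk K p k).filter (fun x => chi p k x ∣ h)).card = n := by
  have h1 : ∀ k ∈ Finset.Icc 1 n, ((Fk K p k).filter (fun x => chi p k x ∣ h)).card =
      ∑ x ∈ h.roots.toFinset, if x ^ p ^ k = x ∧ chi p k x ∣ h then 1 else 0 := by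
    intro k hk
    have hk0 : k ≠ 0 := by have := (Finset.mem_Icc.1 hk).1; omega
    rw [← Finset.card_filter]
    congr 1
    ext x
    simp only [Finset.mem_filter, mem_Fk p hk0, Multiset.mem_toFinset, mem_roots h0]
    constructor
    · rintro ⟨h1, h2⟩
      refine ⟨?_, h1, h2⟩
      rw [← dvd_iff_isRoot]
      refine dvd_trans ?_ h2
      have := Finset.dvd_prod_of_mem (fun i => (X - C (x ^ p ^ i))) (Finset.mem_range.2 (Nat.pos_of_ne_zero hk0))
      simpa [chi] using this
    · rintro ⟨_, h1, h2⟩; exact ⟨h1, h2⟩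
  rw [Finset.sum_congr rfl h1, Finset.sum_comm]
  have h2 : ∀ x ∈ h.roots.toFinset, (∑ k ∈ Finset.Icc 1 n, if x ^ p ^ k = x ∧ chi p k x ∣ h then 1 else 0)
      = Multiset.count x h.roots := by
    intro x hx
    rw [Multiset.mem_toFinset, mem_roots h0] at hx
    rw [← Finset.card_filter, count_one p h n hd h0 hh x hx, count_roots]
  rw [Finset.sum_congr rfl h2, Multiset.toFinset_sum_count_eq,
    ← (IsAlgClosed.splits _).natDegree_eq_card_roots, hd]

/-- multiplicative function on polynomials -/
noncomputable def lam (Ψ : AddChar K ℂ) (f h : K[X]) : ℂ := Ψ ((h.roots.map (fun x => f.eval x)).sum)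

lemma lam_mul (Ψ : AddChar K ℂ) (f h₁ h₂ : K[X]) (h1 : h₁ ≠ 0) (h2 : h₂ ≠ 0) :
    lam Ψ f (h₁ * h₂) = lam Ψ f h₁ * lam Ψ f h₂ := by
  rw [lam, roots_mul (mul_ne_zero h1 h2), Multiset.map_add, Multiset.sum_add, AddChar.map_add_eq_mul]
  rfl

noncomputable def cn [Algebra (ZMod p) K] (Ψ : AddChar K ℂ) (f : K[X]) (n : ℕ) : ℂ := ∑ h ∈ Mn K p n, lam Ψ f h

noncomputable def Sk (Ψ : AddChar K ℂ) (f : K[X]) (k : ℕ) : ℂ :=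
  ∑ x ∈ Fk K p k, Ψ (∑ i ∈ Finset.range k, f.eval x ^ p ^ i)

lemma lam_chi (Ψ : AddChar K ℂ) (f : K[X]) (hf : f.map (frobenius K p) = f) (k : ℕ) (x : K) :
    lam Ψ f (chi p k x) = Ψ (∑ i ∈ Finset.range k, f.eval x ^ p ^ i) := by
  have h1 : ∀ i, f.eval (x ^ p ^ i) = f.eval x ^ p ^ i := by
    intro i
    induction i with
    | zero => simp
    | succ i ih =>
      rw [pow_succ, pow_mul, pow_mul, ← ih]
      conv_lhs => rw [← hf]
      rw [← frobenius_def p (x ^ p ^ i), eval_map_apply, frobenius_def]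
  rw [lam, chi_roots, Multiset.map_map]
  congr 1
  simp only [Function.comp_def, h1]
  rfl

lemma Sk_mul_cn [Algebra (ZMod p) K] (Ψ : AddChar K ℂ) (f : K[X]) (hf : f.map (frobenius K p) = f) (k n : ℕ)
    (hk : k ≠ 0) (hkn : k ≤ n) :
    Sk p Ψ f k * cn p Ψ f (n - k) = ∑ h ∈ Mn K p n, ∑ x ∈ (Fk K p k).filter (fun x => chi p k x ∣ h), lam Ψ f h := by
  rw [Sk, Finset.sum_mul]
  have h1 : ∀ x ∈ Fk K p k, Ψ (∑ i ∈ Finset.range k, f.eval x ^ p ^ i) * cn p Ψ f (n - k) =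
      ∑ h ∈ (Mn K p n).filter (fun h => chi p k x ∣ h), lam Ψ f h := by
    intro x hx
    rw [mem_Fk p hk] at hx
    rw [← lam_chi p Ψ f hf, cn, Finset.mul_sum]
    have hχ0 : chi p k x ≠ 0 := (chi_monic p k x).ne_zero
    refine Finset.sum_nbij (fun h => chi p k x * h) ?_ ?_ ?_ ?_
    · intro h hh
      obtain ⟨hm, hd, hfix⟩ := (mem_Mn p h).1 hh
      refine Finset.mem_filter.2 ⟨(mem_Mn p _).2 ⟨(chi_monic p k x).mul hm, ?_, ?_⟩, dvd_mul_right _ _⟩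
      · rw [(chi_monic p k x).natDegree_mul hm, chi_natDegree, hd]; omega
      · rw [Polynomial.map_mul, chi_map p k x hx, hfix]
    · intro a _ b _ hab
      exact mul_left_cancel₀ hχ0 hab
    · intro h hh
      obtain ⟨hM, q, rfl⟩ := Finset.mem_filter.1 hh
      obtain ⟨hm, hd, hfix⟩ := (mem_Mn p _).1 hM
      have hq : q.Monic := (chi_monic p k x).of_mul_monic_left hm
      refine ⟨q, (mem_Mn p q).2 ⟨hq, ?_, ?_⟩, rfl⟩
      · rw [(chi_monic p k x).natDegree_mul hq, chi_natDegree] at hd; omega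
      · rw [Polynomial.map_mul, chi_map p k x hx] at hfix
        exact mul_left_cancel₀ hχ0 hfix
    · intro h hh
      obtain ⟨hm, hd, hfix⟩ := (mem_Mn p h).1 hh
      rw [lam_mul Ψ f _ _ hχ0 hm.ne_zero]
  rw [Finset.sum_congr rfl h1]
  refine Finset.sum_comm' ?_
  intro x h
  simp only [Finset.mem_filter]
  tauto

lemma recurrence [Algebra (ZMod p) K] (Ψ : AddChar K ℂ) (f : K[X]) (hf : f.map (frobenius K p) = f) (n : ℕ) :
    (n : ℂ) * cn p Ψ f n = ∑ k ∈ Finset.Icc 1 n, Sk p Ψ f k * cn p Ψ f (n - k) := by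
  have h1 : ∀ k ∈ Finset.Icc 1 n, Sk p Ψ f k * cn p Ψ f (n - k) = ∑ h ∈ Mn K p n,
      ((((Fk K p k).filter (fun x => chi p k x ∣ h)).card : ℕ) : ℂ) * lam Ψ f h := by
    intro k hk
    rw [Finset.mem_Icc] at hk
    rw [Sk_mul_cn p Ψ f hf k n (by omega) hk.2]
    simp
  rw [Finset.sum_congr rfl h1, Finset.sum_comm, cn, Finset.mul_sum]
  refine Finset.sum_congr rfl fun h hh => ?_
  obtain ⟨hm, hd, hfix⟩ := (mem_Mn p h).1 hh
  rw [← Finset.sum_mul, ← Nat.cast_sum, count_all p h n hd hm.ne_zero hfix]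

lemma cn_zero [Algebra (ZMod p) K] (Ψ : AddChar K ℂ) (f : K[X]) : cn p Ψ f 0 = 1 := by
  simp [cn, Mn, lam]

end B1
end CWS


namespace CWS
open Polynomial
open scoped Classical

section B2
set_option linter.unusedSectionVars false
set_option linter.unusedVariables false

lemma newton_ms {R : Type*} [CommRing R] (s : Multiset R) (k : ℕ) :
    (k : R) * s.esymm k = (-1) ^ (k + 1) *
      ∑ a ∈ Finset.HasAntidiagonal.antidiagonal k with a.1 < k,
        (-1) ^ a.1 * s.esymm a.1 * (s.map (fun x => x ^ a.2)).sum := by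
  obtain ⟨l, rfl⟩ : ∃ l : List R, (l : Multiset R) = s := ⟨s.toList, s.coe_toList⟩
  have hs : Multiset.map l.get Finset.univ.val = (l : Multiset R) := by
    simp
  have hpow : ∀ j, MvPolynomial.aeval l.get (MvPolynomial.psum (Fin l.length) R j)
      = ((l : Multiset R).map (fun x => x ^ j)).sum := by
    intro j
    rw [MvPolynomial.psum, map_sum, ← hs, Multiset.map_map]
    simp only [map_pow, MvPolynomial.aeval_X]
    rfl
  have hes : ∀ j, MvPolynomial.aeval l.get (MvPolynomial.esymm (Fin l.length) R j)
      = (l : Multiset R).esymm j := by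
    intro j
    rw [MvPolynomial.aeval_esymm_eq_multiset_esymm, hs]
  have := congrArg (MvPolynomial.aeval l.get) (MvPolynomial.mul_esymm_eq_sum (Fin l.length) R k)
  simpa only [map_mul, map_natCast, hes, map_pow, map_neg, map_one, map_sum, hpow] using this

lemma antidiag_sum {R : Type*} [AddCommMonoid R] (g : ℕ → ℕ → R) (k : ℕ) :
    ∑ a ∈ Finset.HasAntidiagonal.antidiagonal k with a.1 < k, g a.1 a.2 =
      ∑ j ∈ Finset.Icc 1 k, g (k - j) j := by
  refine Finset.sum_nbij' (fun a => a.2) (fun j => (k - j, j)) ?_ ?_ ?_ ?_ ?_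
  · rintro ⟨a, b⟩ h
    simp only [Finset.mem_filter, Finset.HasAntidiagonal.mem_antidiagonal] at h
    simp only [Finset.mem_Icc]; omega
  · intro j hj
    simp only [Finset.mem_Icc] at hj
    simp only [Finset.mem_filter, Finset.HasAntidiagonal.mem_antidiagonal]; omega
  · rintro ⟨a, b⟩ h
    simp only [Finset.mem_filter, Finset.HasAntidiagonal.mem_antidiagonal] at h
    simp only [Prod.mk.injEq, and_true]; omega
  · intro j hj; rfl
  · rintro ⟨a, b⟩ h
    simp only [Finset.mem_filter, Finset.HasAntidiagonal.mem_antidiagonal] at h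
    have : k - b = a := by omega
    simp only [this]

/-- Newton, in a convenient form -/
lemma newton_ms' {R : Type*} [CommRing R] (s : Multiset R) (k : ℕ) :
    (k : R) * s.esymm k = (-1) ^ (k + 1) *
      ∑ j ∈ Finset.Icc 1 k,
        (-1) ^ (k - j) * s.esymm (k - j) * (s.map (fun x => x ^ j)).sum := by
  rw [newton_ms, antidiag_sum (fun a b => (-1) ^ a * s.esymm a * (s.map (fun x => x ^ b)).sum)]

lemma esymm_zero' {R : Type*} [CommRing R] (s : Multiset R) : s.esymm 0 = 1 := by
  simp [Multiset.esymm]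

lemma psum_eq_of {R : Type*} [CommRing R] (s s' : Multiset R) (D : ℕ)
    (he : ∀ i, i < D → s.esymm i = s'.esymm i) :
    ∀ k, 1 ≤ k → k < D → (s.map (fun x => x ^ k)).sum = (s'.map (fun x => x ^ k)).sum := by
  intro k
  induction k using Nat.strong_induction_on with
  | _ k ih =>
    intro hk hkD
    have h1 := newton_ms' s k
    have h2 := newton_ms' s' k
    rw [he k hkD, h2] at h1
    have hu : IsUnit ((-1 : R) ^ (k+1)) := (isUnit_one.neg).pow _
    have h3 := hu.mul_left_cancel h1
    obtain ⟨k, rfl⟩ : ∃ l, k = l + 1 := ⟨k - 1, by omega⟩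
    rw [Finset.sum_Icc_succ_top (by omega), Finset.sum_Icc_succ_top (by omega)] at h3
    have h4 : ∑ j ∈ Finset.Icc 1 k, (-1 : R) ^ (k + 1 - j) * s'.esymm (k + 1 - j) * (s'.map (fun x => x ^ j)).sum =
       ∑ j ∈ Finset.Icc 1 k, (-1) ^ (k + 1 - j) * s.esymm (k + 1 - j) * (s.map (fun x => x ^ j)).sum := by
      refine Finset.sum_congr rfl fun j hj => ?_
      rw [Finset.mem_Icc] at hj
      rw [ih j (by omega) hj.1 (by omega), he _ (by omega)]
    rw [h4] at h3
    have h5 := add_left_cancel h3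
    simpa [esymm_zero'] using h5.symm

lemma psum_top {R : Type*} [CommRing R] (s s' : Multiset R) (D : ℕ) (hD : 1 ≤ D)
    (he : ∀ i, i < D → s.esymm i = s'.esymm i) :
    (s'.map (fun x => x ^ D)).sum - (s.map (fun x => x ^ D)).sum
      = (-1) ^ (D + 1) * D * (s'.esymm D - s.esymm D) := by
  have h1 := newton_ms' s D
  have h2 := newton_ms' s' D
  have hps := psum_eq_of s s' D he
  obtain ⟨k, rfl⟩ : ∃ l, D = l + 1 := ⟨D - 1, by omega⟩
  rw [Finset.sum_Icc_succ_top (by omega)] at h1 h2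
  have h4 : ∑ j ∈ Finset.Icc 1 k, (-1 : R) ^ (k + 1 - j) * s'.esymm (k + 1 - j) * (s'.map (fun x => x ^ j)).sum =
       ∑ j ∈ Finset.Icc 1 k, (-1) ^ (k + 1 - j) * s.esymm (k + 1 - j) * (s.map (fun x => x ^ j)).sum := by
    refine Finset.sum_congr rfl fun j hj => ?_
    rw [Finset.mem_Icc] at hj
    rw [hps j hj.1 (by omega), he _ (by omega)]
  rw [h4] at h2
  simp only [Nat.sub_self, pow_zero, esymm_zero', one_mul] at h1 h2
  have hsq : ((-1 : R) ^ (k + 1 + 1)) * (-1) ^ (k + 1 + 1) = 1 := by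
    rw [← mul_pow]; simp
  rw [mul_sub, mul_assoc, h2, mul_assoc, h1, ← mul_assoc, hsq, ← mul_assoc, hsq]
  ring

lemma sum_eval_eq {R : Type*} [CommRing R] (f : R[X]) (s : Multiset R) :
    (s.map (fun x => f.eval x)).sum = ∑ i ∈ Finset.range (f.natDegree + 1), f.coeff i * (s.map (fun x => x ^ i)).sum := by
  induction s using Multiset.induction_on with
  | empty => simp
  | cons a s ih =>
    simp only [Multiset.map_cons, Multiset.sum_cons, ih, mul_add, Finset.sum_add_distrib]
    rw [eval_eq_sum_range]

lemma sum_eval_diff {R : Type*} [CommRing R] (f : R[X]) (s s' : Multiset R) (D : ℕ) (hD : 1 ≤ D)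
    (hf : f.natDegree = D) (hc : s.card = s'.card)
    (he : ∀ i, i < D → s.esymm i = s'.esymm i) :
    (s'.map (fun x => f.eval x)).sum = (s.map (fun x => f.eval x)).sum +
      f.coeff D * ((-1) ^ (D + 1) * D * (s'.esymm D - s.esymm D)) := by
  rw [← psum_top s s' D hD he, sum_eval_eq, sum_eval_eq, hf, Finset.sum_range_succ, Finset.sum_range_succ]
  have : ∑ i ∈ Finset.range D, f.coeff i * (s'.map (fun x => x ^ i)).sum =
      ∑ i ∈ Finset.range D, f.coeff i * (s.map (fun x => x ^ i)).sum := by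
    refine Finset.sum_congr rfl fun i hi => ?_
    rw [Finset.mem_range] at hi
    rcases Nat.eq_zero_or_pos i with rfl | h
    · simp [hc]
    · rw [psum_eq_of s s' D he i h hi]
  rw [this]; ring

lemma esymm_roots {K : Type*} [Field K] [IsAlgClosed K] (h : K[X]) (hm : h.Monic) (n : ℕ)
    (hd : h.natDegree = n) (j : ℕ) (hj : j ≤ n) : h.roots.esymm j = (-1) ^ j * h.coeff (n - j) := by
  have h1 := coeff_eq_esymm_roots_of_card (p := h) ((IsAlgClosed.splits _).natDegree_eq_card_roots).symm
    (k := n - j) (by omega)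
  rw [hm.leadingCoeff, one_mul, hd, show n - (n - j) = j by omega] at h1
  rw [h1, ← mul_assoc, ← mul_pow]; simp

lemma cn_vanish {K : Type*} [Field K] [IsAlgClosed K] (p : ℕ) [hp : Fact p.Prime] [CharP K p]
    [Algebra (ZMod p) K] (Ψ : AddChar K ℂ) (b : ZMod p) (hb : Ψ (algebraMap (ZMod p) K b) ≠ 1)
    (f : (ZMod p)[X]) (D : ℕ) (hf : f.natDegree = D) (hD : 1 ≤ D) (hDp : D < p) (n : ℕ) (hn : D ≤ n) :
    cn p Ψ (f.map (algebraMap (ZMod p) K)) n = 0 := by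
  set F := f.map (algebraMap (ZMod p) K) with hF
  have hFd : F.natDegree = D := by rw [hF, natDegree_map, hf]
  have hl : f.coeff D ≠ 0 := by
    rw [← hf]; exact leadingCoeff_ne_zero.2 (by rintro rfl; simp at hf; omega)
  have hD0 : (D : ZMod p) ≠ 0 := by
    rw [Ne, ZMod.natCast_eq_zero_iff]
    intro h; exact absurd (Nat.le_of_dvd (by omega) h) (by omega)
  set c : ZMod p := - b / (f.coeff D * D) with hc
  have hcb : - (f.coeff D * D * c) = b := by
    rw [hc]; field_simp
  set τ : K[X] := C (algebraMap (ZMod p) K c) * X ^ (n - D) with hτ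
  have hτd : τ.natDegree < n := by
    refine lt_of_le_of_lt (natDegree_C_mul_X_pow_le _ _) (by omega)
  have hτfix : τ.map (frobenius K p) = τ := by
    simp [hτ, frobenius_def, ← map_pow, ZMod.pow_card]
  have hτc : ∀ i, τ.coeff i = if i = n - D then algebraMap (ZMod p) K c else 0 := by
    intro i; rw [hτ, coeff_C_mul, coeff_X_pow]; simp
  have htr : ∀ σ : K[X], σ.natDegree < n → σ.map (frobenius K p) = σ → ∀ h ∈ Mn K p n, h + σ ∈ Mn K p n := by
    intro σ hσ hσf h hh
    obtain ⟨hm, hd, hfix⟩ := (mem_Mn p h).1 hh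
    rw [mem_Mn]
    have hlt : σ.natDegree < h.natDegree := by omega
    refine ⟨hm.add_of_left (degree_lt_degree hlt), ?_, ?_⟩
    · rw [natDegree_add_eq_left_of_natDegree_lt hlt, hd]
    · rw [Polynomial.map_add, hfix, hσf]
  have key : ∀ h ∈ Mn K p n, lam Ψ F (h + τ) = lam Ψ F h * Ψ (algebraMap (ZMod p) K b) := by
    intro h hh
    obtain ⟨hm, hd, hfix⟩ := (mem_Mn p h).1 hh
    obtain ⟨hm', hd', hfix'⟩ := (mem_Mn p _).1 (htr τ hτd hτfix h hh)
    rw [lam, lam, ← AddChar.map_add_eq_mul, sum_eval_diff F h.roots (h + τ).roots D hD hFd]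
    · congr 2
      rw [esymm_roots h hm n hd D hn, esymm_roots (h+τ) hm' n hd' D hn, coeff_add, hτc, if_pos rfl, ← hcb, hF, coeff_map]
      simp only [map_neg, map_mul, map_natCast]
      have hsq : ((-1 : K) ^ D) * (-1) ^ D = 1 := by rw [← mul_pow]; simp
      rw [pow_succ]
      linear_combination (-(algebraMap (ZMod p) K (f.coeff D)) * D * (algebraMap (ZMod p) K c)) * hsq
    · rw [← (IsAlgClosed.splits _).natDegree_eq_card_roots, ← (IsAlgClosed.splits _).natDegree_eq_card_roots, hd, hd']
    · intro i hi
      rw [esymm_roots h hm n hd i (by omega), esymm_roots (h+τ) hm' n hd' i (by omega), coeff_add, hτc, if_neg (by omega), add_zero]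
  have hsum : cn p Ψ F n = cn p Ψ F n * Ψ (algebraMap (ZMod p) K b) := by
    conv_rhs => rw [cn, Finset.sum_mul, ← Finset.sum_congr rfl key]
    rw [cn]
    symm
    refine Finset.sum_nbij' (fun h => h + τ) (fun h => h + -τ) (htr τ hτd hτfix) (htr (-τ) (by rwa [natDegree_neg]) (by rw [Polynomial.map_neg, hτfix])) ?_ ?_ ?_
    · intro h _; simp
    · intro h _; simp
    · intro h _; rfl
  have h3 : cn p Ψ F n * (Ψ (algebraMap (ZMod p) K b) - 1) = 0 := by
    rw [mul_sub, ← hsum]; ring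
  exact (mul_eq_zero.1 h3).resolve_right (sub_ne_zero.2 hb)

lemma rational_L (D : ℕ) (hD : 1 ≤ D) (c S : ℕ → ℂ) (hc0 : c 0 = 1) (hc : ∀ n, D ≤ n → c n = 0)
    (hrec : ∀ n : ℕ, (n : ℂ) * c n = ∑ k ∈ Finset.Icc 1 n, S k * c (n - k)) :
    ∃ s : Multiset ℂ, s.card = D - 1 ∧ ∀ k, 1 ≤ k → S k = - (s.map (fun x => x ^ k)).sum := by
  obtain ⟨E, rfl⟩ : ∃ E, D = E + 1 := ⟨D - 1, by omega⟩
  set L : ℂ[X] := X ^ E + ∑ i : Fin E, C (c (E - i)) * X ^ (i : ℕ) with hL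
  have hd : (∑ i : Fin E, C (c (E - i)) * X ^ (i : ℕ)).degree < (E : WithBot ℕ) := by
    rw [degree_lt_iff_coeff_zero]
    intro m hm
    rw [finsetSum_coeff]
    refine Finset.sum_eq_zero fun i _ => ?_
    rw [coeff_C_mul, coeff_X_pow, if_neg (by have := i.2; omega), mul_zero]
  have hm : L.Monic := monic_X_pow_add hd
  have hLd : L.natDegree = E := by
    apply natDegree_eq_of_degree_eq_some
    rw [hL, degree_add_eq_left_of_degree_lt (by simpa using hd), degree_X_pow]
  have hLc : ∀ j, j ≤ E → L.coeff (E - j) = c j := by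
    intro j hj
    rw [hL, coeff_add, coeff_X_pow, finsetSum_coeff]
    simp only [coeff_C_mul, coeff_X_pow]
    rw [Fin.sum_univ_eq_sum_range (fun i => c (E - i) * if E - j = i then 1 else 0)]
    rcases Nat.eq_zero_or_pos j with rfl | hj0
    · simp [hc0]
    · rw [if_neg (by omega), zero_add, Finset.sum_eq_single (E - j)]
      · rw [if_pos rfl, mul_one]; congr 1; omega
      · intro b _ hb; rw [if_neg (Ne.symm hb), mul_zero]
      · intro h; exact absurd (Finset.mem_range.2 (by omega)) h
  have hcard : L.roots.card = E := by
    rw [← (IsAlgClosed.splits _).natDegree_eq_card_roots, hLd]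
  refine ⟨L.roots, by simpa using hcard, ?_⟩
  have hes : ∀ j, L.roots.esymm j = (-1) ^ j * c j := by
    intro j
    by_cases hj : j ≤ E
    · rw [esymm_roots L hm E hLd j hj, hLc j hj]
    · rw [hc j (by omega), Multiset.esymm, Multiset.powersetCard_eq_empty _ (by omega)]; simp
  intro k
  induction k using Nat.strong_induction_on with
  | _ k ih =>
    intro hk
    have h1 := newton_ms' L.roots k
    have h2 := hrec k
    simp only [hes] at h1
    have hsq : ∀ j, ((-1 : ℂ) ^ j) * (-1) ^ j = 1 := fun j => by rw [← mul_pow]; simp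
    simp only [← mul_assoc, hsq, one_mul] at h1
    have h3 : (k : ℂ) * c k = - ∑ j ∈ Finset.Icc 1 k, c (k - j) * (L.roots.map (fun x => x ^ j)).sum := by
      have h4 := congrArg (fun z => (-1 : ℂ) ^ k * z) h1
      rw [pow_succ] at h4
      have h5 := hsq k
      linear_combination h4 - (k * c k) * h5 - (∑ j ∈ Finset.Icc 1 k, c (k - j) * (L.roots.map (fun x => x ^ j)).sum) * h5
    rw [h2] at h3
    obtain ⟨k, rfl⟩ : ∃ l, k = l + 1 := ⟨k - 1, by omega⟩
    rw [Finset.sum_Icc_succ_top (by omega), Finset.sum_Icc_succ_top (by omega)] at h3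
    have h4 : ∑ j ∈ Finset.Icc 1 k, S j * c (k + 1 - j) = - ∑ j ∈ Finset.Icc 1 k, c (k + 1 - j) * (L.roots.map (fun x => x ^ j)).sum := by
      rw [← Finset.sum_neg_distrib]
      refine Finset.sum_congr rfl fun j hj => ?_
      rw [Finset.mem_Icc] at hj
      rw [ih j (by omega) hj.1]; ring
    rw [h4, Nat.sub_self, hc0] at h3
    linear_combination h3

lemma power_bound {N : ℕ} (z : Fin N → ℂ) (A B : ℝ) (hB : 0 < B) (r0 : ℕ)
    (h : ∀ r, r0 ≤ r → ‖∑ i, z i ^ (2 * r)‖ ≤ A * B ^ (2 * r)) (i : Fin N) : ‖z i‖ ≤ B := by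
  by_contra! hlt
  let u : Fin N → Circle := fun i => if hz : z i = 0 then 1 else
    ⟨z i ^ 2 / (‖z i‖ ^ 2 : ℝ), by
      refine mem_sphere_zero_iff_norm.2 ?_
      simp [hz]⟩
  have hu : ∀ j, ((‖z j‖ ^ 2 : ℝ) : ℂ) * (u j : ℂ) = z j ^ 2 := by
    intro j
    by_cases hz : z j = 0
    · simp [hz]
    · have : (u j : ℂ) = z j ^ 2 / (‖z j‖ ^ 2 : ℝ) := by simp [u, hz]
      rw [this, mul_div_cancel₀]
      simp [hz]
  have hcl := mapClusterPt_one_atTop_pow u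
  have hnb : ∀ᶠ w : Fin N → Circle in nhds 1, ∀ j, (1/2 : ℝ) < ((w j : ℂ)).re := by
    rw [Filter.eventually_all]
    intro j
    have hcont : Continuous (fun w : Fin N → Circle => ((w j : ℂ)).re) := by fun_prop
    apply hcont.continuousAt.eventually_const_lt
    simp; norm_num
  have hfr := hcl.frequently hnb
  have hratio : 1 < ‖z i‖ ^ 2 / B ^ 2 := by
    rw [one_lt_div (by positivity)]
    exact pow_lt_pow_left₀ hlt hB.le (by norm_num)
  have htend := (tendsto_pow_atTop_atTop_of_one_lt hratio).eventually_gt_atTop (2 * A)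
  obtain ⟨r, hr, hr2, hr0⟩ := (hfr.and_eventually (htend.and (Filter.eventually_ge_atTop r0))).exists
  have h1 := h r hr0
  have hre : ∀ j, (1/2) * (‖z j‖ ^ 2) ^ r ≤ (z j ^ (2 * r)).re := by
    intro j
    rw [pow_mul, ← hu j, mul_pow, ← Complex.ofReal_pow, Complex.re_ofReal_mul]
    have := hr j
    simp only [Pi.pow_apply, Circle.coe_pow] at this
    nlinarith [pow_nonneg (sq_nonneg ‖z j‖) r]
  have h2 : (1/2) * (‖z i‖ ^ 2) ^ r ≤ ‖∑ j, z j ^ (2 * r)‖ := by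
    refine le_trans ?_ (Complex.re_le_norm _)
    rw [Complex.re_sum]
    refine le_trans (hre i) (Finset.single_le_sum (f := fun j => (z j ^ (2 * r)).re) ?_ (Finset.mem_univ i))
    intro j _
    refine le_trans ?_ (hre j)
    positivity
  rw [div_pow, lt_div_iff₀ (by positivity)] at hr2
  rw [pow_mul B] at h1
  linarith

end B2
end CWS


namespace CWS
open Polynomial
open scoped Classical

section B3

lemma nontriv_bound {p : ℕ} [hp : Fact p.Prime] (ψ : AddChar (ZMod p) ℂ) (hψ : ψ ≠ 1) {X : Type*} (s : Finset X)
    (T : X → ZMod p) (M : ℕ) (hM : ∀ t, (s.filter (fun x => T x = t)).card ≤ M) :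
    ‖∑ x ∈ s, ψ (T x)‖ ≤ (p : ℝ) * M - s.card := by
  have h1 : ∑ x ∈ s, ψ (T x) = ∑ t : ZMod p, ((s.filter (fun x => T x = t)).card : ℂ) * ψ t := by
    rw [← Finset.sum_fiberwise s T]
    refine Finset.sum_congr rfl fun t _ => ?_
    rw [Finset.sum_congr rfl (g := fun _ => ψ t), Finset.sum_const, nsmul_eq_mul]
    intro x hx
    rw [(Finset.mem_filter.1 hx).2]
  have h2 : ∑ t : ZMod p, ψ t = 0 := AddChar.sum_eq_zero_of_ne_one hψ
  have h3 : ∑ x ∈ s, ψ (T x) = - ∑ t : ZMod p, (((M : ℝ) - (s.filter (fun x => T x = t)).card : ℝ) : ℂ) * ψ t := by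
    rw [h1]
    push_cast
    simp only [sub_mul, Finset.sum_sub_distrib, ← Finset.mul_sum, h2]
    ring
  rw [h3, norm_neg]
  refine (norm_sum_le _ _).trans ?_
  have h4 : ∀ t : ZMod p, ‖(((M : ℝ) - (s.filter (fun x => T x = t)).card : ℝ) : ℂ) * ψ t‖ = (M : ℝ) - (s.filter (fun x => T x = t)).card := by
    intro t
    rw [norm_mul, AddChar.norm_apply, mul_one, Complex.norm_real, Real.norm_of_nonneg]
    rw [sub_nonneg]; exact_mod_cast hM t
  simp only [h4]
  rw [Finset.sum_sub_distrib]
  have h5 : s.card = ∑ t : ZMod p, (s.filter (fun x => T x = t)).card :=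
    Finset.card_eq_sum_card_fiberwise (fun _ _ => Finset.mem_coe.2 (Finset.mem_univ _))
  rw [h5]
  simp [ZMod.card]

theorem weil (p : ℕ) [hp : Fact p.Prime] (ψ : AddChar (ZMod p) ℂ) (hψ : ψ ≠ 1) (f : (ZMod p)[X]) (D : ℕ)
    (hf : f.natDegree = D) (hD : 1 ≤ D) (hDp : D < p) :
    ‖∑ x : ZMod p, ψ (f.eval x)‖ ≤ D * Real.sqrt p := by
  let K := AlgebraicClosure (ZMod p)
  have : CharP K p := charP_of_injective_algebraMap (algebraMap (ZMod p) K).injective p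
  obtain ⟨π, hπ⟩ := LinearMap.exists_leftInverse_of_injective (Algebra.linearMap (ZMod p) K)
    (LinearMap.ker_eq_bot.2 (algebraMap (ZMod p) K).injective)
  have hπ' : ∀ a : ZMod p, π (algebraMap (ZMod p) K a) = a := fun a => LinearMap.congr_fun hπ a
  let Ψ : AddChar K ℂ := ψ.compAddMonoidHom π.toAddMonoidHom
  have hΨ : ∀ x, Ψ x = ψ (π x) := fun x => rfl
  set F : K[X] := f.map (algebraMap (ZMod p) K) with hF
  have hFd : F.natDegree = D := by rw [hF, natDegree_map, hf]
  have hFF : F.map (frobenius K p) = F := by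
    rw [hF, Polynomial.map_map]; congr 1
    exact RingHom.ext fun a => by simp [frobenius_def, ← map_pow, ZMod.pow_card]
  obtain ⟨b, hb⟩ : ∃ b, ψ b ≠ 1 := by
    by_contra! h
    exact hψ (DFunLike.ext _ _ fun x => by simp [h x])
  obtain ⟨s, hs, hS⟩ := rational_L D hD (cn p Ψ F) (Sk p Ψ F) (cn_zero p Ψ F)
    (fun n hn => cn_vanish p Ψ b (by rw [hΨ, hπ']; exact hb) f D hf hD hDp n hn)
    (recurrence p Ψ F hFF)
  have hT : ∀ k, k ≠ 0 → ∀ x ∈ Fk K p k, algebraMap (ZMod p) K (π (∑ i ∈ Finset.range k, F.eval x ^ p ^ i)) = ∑ i ∈ Finset.range k, F.eval x ^ p ^ i := by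
    intro k hk x hx
    rw [mem_Fk p hk] at hx
    have hy : F.eval x ^ p ^ k = F.eval x := by
      have h0 : ∀ j, F.eval (x ^ p ^ j) = F.eval x ^ p ^ j := by
        intro j
        induction j with
        | zero => simp
        | succ j ih =>
          rw [pow_succ, pow_mul, pow_mul, ← ih, ← frobenius_def p (x ^ p ^ j), ← frobenius_def p (F.eval _)]
          conv_lhs => rw [← hFF]
          rw [eval_map_apply]
      rw [← h0, hx]
    obtain ⟨a, ha⟩ := (fixed_iff p (∑ i ∈ Finset.range k, F.eval x ^ p ^ i)).1 (by
      rw [sum_pow_char]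
      simp only [← pow_mul, ← pow_succ]
      have := Finset.sum_range_succ' (fun i => F.eval x ^ p ^ i) k
      rw [Finset.sum_range_succ, hy] at this
      simp only [pow_zero, pow_one] at this
      exact (add_right_cancel this).symm)
    rw [← ha, hπ']
  have hp0 : (0 : ℝ) < p := by exact_mod_cast hp.out.pos
  have hz : ∀ z ∈ s, ‖z‖ ≤ Real.sqrt p := by
    let z : Fin s.toList.length → ℂ := fun i => s.toList.get i
    have hsum : ∀ k, ∑ i, z i ^ k = (s.map (fun x => x ^ k)).sum := by
      intro k
      conv_rhs => rw [← Multiset.coe_toList s]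
      rw [Multiset.map_coe, Multiset.sum_coe]
      conv_rhs => rw [← List.ofFn_get s.toList]
      rw [List.map_ofFn, List.sum_ofFn]
      rfl
    have key := power_bound z (p * (2 * D + 1)) (Real.sqrt p) (Real.sqrt_pos.2 hp0) (D + 3) (by
      intro r hr
      obtain ⟨r, rfl⟩ : ∃ q, r = q + 1 := ⟨r - 1, by omega⟩
      have hk : 2 * (r + 1) ≠ 0 := by omega
      have e1 := hS (2 * (r + 1)) (by omega)
      rw [hsum, ← norm_neg, ← e1, Sk]
      simp only [hΨ]
      refine (nontriv_bound ψ hψ (Fk K p (2 * (r+1))) (fun x => π (∑ i ∈ Finset.range (2 * (r + 1)), F.eval x ^ p ^ i)) (p ^ (2 * (r+1) - 1) + (2 * D + 1) * p ^ (r+1)) ?_).trans ?_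
      · intro t
        refine stepanov p F D r hFd hD ?_ ?_ (algebraMap (ZMod p) K t) _ ?_
        · exact ((hp.out.coprime_iff_not_dvd.2 (Nat.not_dvd_of_pos_of_lt hD hDp)).symm)
        · calc D + 2 ≤ r := by omega
            _ ≤ p ^ r := (Nat.lt_pow_self hp.out.one_lt).le
        · intro x hx
          rw [Finset.mem_filter] at hx
          refine ⟨(mem_Fk p hk x).1 hx.1, ?_⟩
          rw [← hT _ hk x hx.1, hx.2]
      · rw [card_Fk p hk, pow_mul (Real.sqrt p), Real.sq_sqrt hp0.le]
        have : (p : ℝ) ^ (2 * (r + 1)) = p * p ^ (2 * (r+1) - 1) := by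
          rw [← pow_succ']; congr 1
        push_cast
        rw [this]
        apply le_of_eq; ring)
    intro w hw
    obtain ⟨i, hi⟩ := List.get_of_mem (Multiset.mem_toList.2 hw)
    rw [← hi]; exact key i
  have h1 := hS 1 le_rfl
  have h2 : Sk p Ψ F 1 = ∑ x : ZMod p, ψ (f.eval x) := by
    rw [Sk]
    symm
    refine Finset.sum_bij (fun a _ => algebraMap (ZMod p) K a) ?_ ?_ ?_ ?_
    · intro a _; rw [mem_Fk p one_ne_zero, pow_one, ← map_pow, ZMod.pow_card]
    · intro a _ b _ h; exact (algebraMap (ZMod p) K).injective h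
    · intro x hx
      rw [mem_Fk p one_ne_zero, pow_one, fixed_iff] at hx
      obtain ⟨a, ha⟩ := hx; exact ⟨a, Finset.mem_univ _, ha⟩
    · intro a _
      simp only [Finset.sum_range_one, pow_zero, pow_one, hΨ, hF, eval_map_apply, hπ']
  rw [← h2, h1, norm_neg]
  refine (norm_multiset_sum_le _).trans ?_
  rw [Multiset.map_map]
  refine (Multiset.sum_le_card_nsmul _ (Real.sqrt p) ?_).trans ?_
  · intro x hx
    obtain ⟨w, hw, rfl⟩ := Multiset.mem_map.1 hx
    simpa using hz w hw
  · rw [Multiset.card_map, hs, nsmul_eq_mul]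
    apply mul_le_mul_of_nonneg_right _ (Real.sqrt_nonneg _)
    exact_mod_cast Nat.sub_le _ _

end B3
end CWS


namespace CWS
open Polynomial
open scoped Classical

section D1
variable (p : ℕ) [hp : Fact p.Prime]

noncomputable def ee : AddChar (ZMod p) ℂ := ZMod.stdAddChar

noncomputable def Jv (α β : ℝ) : Finset (ZMod p) :=
  Finset.univ.filter (fun v => α ≤ (v.val : ℝ) / p ∧ (v.val : ℝ) / p < β)

lemma sum_Jv {M : Type*} [AddCommMonoid M] (α β : ℝ) (hβ : β ≤ 1) (g : ZMod p → M) :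
    ∑ x ∈ Jv p α β, g x = ∑ j ∈ Finset.Ico ⌈α * p⌉₊ ⌈β * p⌉₊, g (j : ZMod p) := by
  have hp0 : (0 : ℝ) < p := by exact_mod_cast hp.out.pos
  refine Finset.sum_bij (fun x _ => x.val) ?_ ?_ ?_ ?_
  · intro x hx
    obtain ⟨_, h1, h2⟩ := Finset.mem_filter.1 hx
    rw [Finset.mem_Ico, Nat.ceil_le, Nat.lt_ceil]
    exact ⟨(le_div_iff₀ hp0).1 h1, (div_lt_iff₀ hp0).1 h2⟩
  · intro x _ y _ h; exact ZMod.val_injective p h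
  · intro j hj
    rw [Finset.mem_Ico, Nat.ceil_le, Nat.lt_ceil] at hj
    have hjp : j < p := by
      have : (j : ℝ) < p := hj.2.trans_le (by nlinarith)
      exact_mod_cast this
    have hv : (j : ZMod p).val = j := ZMod.val_cast_of_lt hjp
    refine ⟨(j : ZMod p), ?_, hv⟩
    rw [Jv, Finset.mem_filter, hv]
    exact ⟨Finset.mem_univ _, (le_div_iff₀ hp0).2 hj.1, (div_lt_iff₀ hp0).2 hj.2⟩
  · intro x _; simp

lemma card_Jv (α β : ℝ) (hα : 0 ≤ α) (hαβ : α ≤ β) (hβ : β ≤ 1) :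
    |((Jv p α β).card : ℝ) - (β - α) * p| ≤ 1 := by
  have hp0 : (0 : ℝ) < p := by exact_mod_cast hp.out.pos
  have h1 : (Jv p α β).card = ⌈β * p⌉₊ - ⌈α * p⌉₊ := by
    rw [Finset.card_eq_sum_ones, sum_Jv p α β hβ, ← Finset.card_eq_sum_ones, Nat.card_Ico]
  have h2 : ⌈α * p⌉₊ ≤ ⌈β * p⌉₊ := Nat.ceil_mono (by nlinarith)
  rw [h1, Nat.cast_sub h2]
  have a1 := Nat.le_ceil (α * p)
  have a2 := Nat.ceil_lt_add_one (a := α * p) (by positivity)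
  have b1 := Nat.le_ceil (β * p)
  have b2 := Nat.ceil_lt_add_one (a := β * p) (by have := hα.trans hαβ; positivity)
  rw [abs_le]; constructor <;> nlinarith

noncomputable def Dh (I : Finset (ZMod p)) (v : ZMod p) : ℂ := ∑ x ∈ I, ee p (v * x)

lemma ee_norm (x : ZMod p) : ‖ee p x‖ = 1 := AddChar.norm_apply _ _

lemma Dh_le_card (I : Finset (ZMod p)) (v : ZMod p) : ‖Dh p I v‖ ≤ I.card := by
  refine (norm_sum_le _ _).trans ?_
  simp [ee_norm]

lemma norm_ee_sub_one (v : ZMod p) (hv : v ≠ 0) :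
    1 / ‖ee p v - 1‖ ≤ (p / 4) * (1 / v.val + 1 / (p - v.val : ℕ)) := by
  have hp0 : (0 : ℝ) < p := by exact_mod_cast hp.out.pos
  have hvp := ZMod.val_lt v
  have hv0 : 0 < v.val := Nat.pos_of_ne_zero fun h => hv ((ZMod.val_eq_zero v).1 h)
  have hv0' : (0 : ℝ) < v.val := by exact_mod_cast hv0
  have hw0' : (0 : ℝ) < (p - v.val : ℕ) := by exact_mod_cast (Nat.sub_pos_of_lt hvp)
  have hw : ((p - v.val : ℕ) : ℝ) = p - v.val := Nat.cast_sub hvp.le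
  have h1 : ‖ee p v - 1‖ = ‖2 * Real.sin (Real.pi * v.val / p)‖ := by
    rw [ee, ZMod.stdAddChar_apply, ZMod.toCircle_apply]
    have := Complex.norm_exp_I_mul_ofReal_sub_one (2 * Real.pi * v.val / p)
    rw [show 2 * Real.pi * v.val / p / 2 = Real.pi * v.val / p by ring] at this
    rw [← this]
    congr 3; push_cast; ring
  have hpi := Real.pi_pos
  rw [h1]
  rcases le_total (2 * v.val) p with h | h
  · have h' : 2 * (v.val : ℝ) ≤ p := by exact_mod_cast h
    have hs := Real.mul_le_sin (x := Real.pi * v.val / p) (by positivity) (by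
      rw [div_le_div_iff₀ hp0 two_pos]; nlinarith)
    have e : 2 / Real.pi * (Real.pi * v.val / p) = 2 * v.val / p := by field_simp
    rw [e] at hs
    have hpos : 0 < 2 * v.val / (p : ℝ) := by positivity
    rw [Real.norm_of_nonneg (by linarith)]
    calc 1 / (2 * Real.sin (Real.pi * v.val / p)) ≤ 1 / (2 * (2 * v.val / p)) :=
          one_div_le_one_div_of_le (by positivity) (by linarith)
      _ = p / 4 * (1 / v.val) := by field_simp; ring
      _ ≤ _ := by
          apply mul_le_mul_of_nonneg_left _ (by positivity)
          have : (0 : ℝ) < 1 / (p - v.val : ℕ) := by positivity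
          linarith
  · have h' : (p : ℝ) ≤ 2 * (v.val : ℝ) := by exact_mod_cast h
    have hs := Real.mul_le_sin (x := Real.pi * (p - v.val : ℕ) / p) (by positivity) (by
      rw [div_le_div_iff₀ hp0 two_pos, hw]; nlinarith)
    have e : 2 / Real.pi * (Real.pi * (p - v.val : ℕ) / p) = 2 * (p - v.val : ℕ) / p := by field_simp
    have e2 : Real.sin (Real.pi * (p - v.val : ℕ) / p) = Real.sin (Real.pi * v.val / p) := by
      rw [← Real.sin_pi_sub]; congr 1; rw [hw]; field_simp; ring
    rw [e, e2] at hs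
    have hpos : 0 < 2 * (p - v.val : ℕ) / (p : ℝ) := by positivity
    rw [Real.norm_of_nonneg (by linarith)]
    calc 1 / (2 * Real.sin (Real.pi * v.val / p)) ≤ 1 / (2 * (2 * (p - v.val : ℕ) / p)) :=
          one_div_le_one_div_of_le (by positivity) (by linarith)
      _ = p / 4 * (1 / (p - v.val : ℕ)) := by field_simp; ring
      _ ≤ _ := by
          apply mul_le_mul_of_nonneg_left _ (by positivity)
          have : (0 : ℝ) < 1 / v.val := by positivity
          linarith

lemma ee_ne_one (v : ZMod p) (hv : v ≠ 0) : ee p v ≠ 1 := by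
  intro h
  have := (ZMod.injective_stdAddChar (N := p)) (a₁ := v) (a₂ := 0) (by
    rw [AddChar.map_zero_eq_one]; exact h)
  exact hv this

lemma Dh_Jv (α β : ℝ) (hαβ : α ≤ β) (hβ : β ≤ 1) (v : ZMod p) (hv : v ≠ 0) :
    ‖Dh p (Jv p α β) v‖ ≤ (p / 2) * (1 / v.val + 1 / (p - v.val : ℕ)) := by
  have hp0 : (0 : ℝ) < p := by exact_mod_cast hp.out.pos
  rw [Dh, sum_Jv p α β hβ]
  have h1 : ∀ j : ℕ, ee p (v * j) = (ee p v) ^ j := by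
    intro j
    rw [mul_comm, ← nsmul_eq_mul, AddChar.map_nsmul_eq_pow]
  simp only [h1]
  rw [geom_sum_Ico (ee_ne_one p v hv) (Nat.ceil_mono (by nlinarith)), norm_div]
  have h2 : ∀ j : ℕ, ‖(ee p v) ^ j‖ = 1 := fun j => by rw [norm_pow, ee_norm, one_pow]
  have h3 := (norm_sub_le ((ee p v) ^ ⌈β * p⌉₊) ((ee p v) ^ ⌈α * p⌉₊))
  rw [h2, h2] at h3
  have h4 := norm_ee_sub_one p v hv
  calc _ ≤ 2 / ‖ee p v - 1‖ := by gcongr; linarith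
    _ = 2 * (1 / ‖ee p v - 1‖) := by ring
    _ ≤ _ := by linarith

lemma sum_nonzero (g : ℕ → ℝ) : ∑ v ∈ Finset.univ.erase (0 : ZMod p), g v.val = ∑ j ∈ Finset.Ico 1 p, g j := by
  refine Finset.sum_bij (fun x _ => x.val) ?_ ?_ ?_ ?_
  · intro x hx
    rw [Finset.mem_Ico]
    exact ⟨Nat.pos_of_ne_zero fun h => (Finset.mem_erase.1 hx).1 ((ZMod.val_eq_zero x).1 h), ZMod.val_lt x⟩
  · intro x _ y _ h; exact ZMod.val_injective p h
  · intro j hj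
    rw [Finset.mem_Ico] at hj
    have hv : (j : ZMod p).val = j := ZMod.val_cast_of_lt hj.2
    refine ⟨(j : ZMod p), Finset.mem_erase.2 ⟨?_, Finset.mem_univ _⟩, hv⟩
    intro h; rw [h] at hv; simp at hv; omega
  · intro x _; rfl

lemma Dh_L1 (α β : ℝ) (hαβ : α ≤ β) (hβ : β ≤ 1) :
    ∑ v : ZMod p, ‖Dh p (Jv p α β) v‖ ≤ (4 * Real.log p) * p := by
  have hp0 : (0 : ℝ) < p := by exact_mod_cast hp.out.pos
  have hp2 : (2 : ℝ) ≤ p := by exact_mod_cast hp.out.two_le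
  rw [← Finset.add_sum_erase _ _ (Finset.mem_univ (0 : ZMod p))]
  have h0 : ‖Dh p (Jv p α β) 0‖ ≤ p := by
    refine (Dh_le_card p _ _).trans ?_
    exact_mod_cast (Finset.card_le_univ _).trans (by rw [ZMod.card])
  have h1 : ∑ v ∈ Finset.univ.erase (0 : ZMod p), ‖Dh p (Jv p α β) v‖ ≤
      ∑ v ∈ Finset.univ.erase (0 : ZMod p), ((p : ℝ) / 2) * (1 / (v.val : ℝ) + 1 / (p - v.val : ℕ)) :=
    Finset.sum_le_sum fun v hv => Dh_Jv p α β hαβ hβ v (Finset.mem_erase.1 hv).1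
  have h2 := sum_nonzero p (fun j => ((p : ℝ) / 2) * (1 / (j : ℝ) + 1 / ((p - j : ℕ) : ℝ)))
  rw [h2, ← Finset.mul_sum, Finset.sum_add_distrib] at h1
  have h3 : ∑ j ∈ Finset.Ico 1 p, (1 : ℝ) / ((p - j : ℕ) : ℝ) = ∑ j ∈ Finset.Ico 1 p, (1 : ℝ) / (j : ℝ) := by
    refine Finset.sum_bij (fun j _ => p - j) ?_ ?_ ?_ ?_
    · intro j hj; rw [Finset.mem_Ico] at *; omega
    · intro i hi j hj h; rw [Finset.mem_Ico] at *; omega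
    · intro j hj; rw [Finset.mem_Ico] at hj; exact ⟨p - j, by rw [Finset.mem_Ico]; omega, by omega⟩
    · intro j _; rfl
  have h4 : ∑ j ∈ Finset.Ico 1 p, (1 : ℝ) / (j : ℝ) ≤ 1 + Real.log p := by
    have hh := harmonic_le_one_add_log p
    rw [harmonic_eq_sum_Icc] at hh
    push_cast at hh
    refine le_trans ?_ hh
    simp only [one_div]
    apply Finset.sum_le_sum_of_subset_of_nonneg
    · intro j hj; rw [Finset.mem_Ico] at hj; rw [Finset.mem_Icc]; omega
    · intros; positivity
  rw [h3] at h1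
  have h5 : 0.69 ≤ Real.log p := by
    have := Real.log_two_gt_d9
    have := Real.log_le_log two_pos hp2
    linarith
  have h6 : (p : ℝ) / 2 * (∑ j ∈ Finset.Ico 1 p, (1 : ℝ) / (j : ℝ) + ∑ j ∈ Finset.Ico 1 p, (1 : ℝ) / (j : ℝ)) ≤ p * (1 + Real.log p) := by
    nlinarith
  nlinarith

lemma ee_orth (x : ZMod p) : ∑ v : ZMod p, ee p (v * x) = if x = 0 then (p : ℂ) else 0 := by
  have := AddChar.sum_mulShift x (ZMod.isPrimitive_stdAddChar p)
  rw [ee, this, ZMod.card]; split_ifs <;> simp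

lemma Dh_neg_L1 (I : Finset (ZMod p)) : ∑ v : ZMod p, ‖Dh p I (-v)‖ = ∑ v : ZMod p, ‖Dh p I v‖ :=
  Equiv.sum_comp (Equiv.neg (ZMod p)) (fun v => ‖Dh p I v‖)

lemma indicator_expand (I : Finset (ZMod p)) (x : ZMod p) :
    (if x ∈ I then (1 : ℂ) else 0) = (1 / p) * ∑ v : ZMod p, Dh p I (-v) * ee p (v * x) := by
  have hp0 : (p : ℂ) ≠ 0 := by exact_mod_cast hp.out.ne_zero
  have h1 : ∑ v : ZMod p, Dh p I (-v) * ee p (v * x) = ∑ z ∈ I, ∑ v : ZMod p, ee p (v * (x - z)) := by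
    rw [Finset.sum_comm]
    refine Finset.sum_congr rfl fun v _ => ?_
    rw [Dh, Finset.sum_mul]
    refine Finset.sum_congr rfl fun z _ => ?_
    rw [← AddChar.map_add_eq_mul]; congr 1; ring
  rw [h1]
  simp only [ee_orth, sub_eq_zero]
  rw [Finset.sum_ite_eq]
  split_ifs <;> field_simp
  simp

lemma completion (I : Finset (ZMod p)) (L M : ℝ) (hL : ∑ v : ZMod p, ‖Dh p I v‖ ≤ L * p) (hM : 0 ≤ M)
    (g : ZMod p → ℂ) (hg : ∀ v, ‖∑ x : ZMod p, g x * ee p (v * x)‖ ≤ M) : ‖∑ x ∈ I, g x‖ ≤ L * M := by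
  have hp0 : (0 : ℝ) < p := by exact_mod_cast hp.out.pos
  have h1 : ∑ x ∈ I, g x = (1 / p) * ∑ v : ZMod p, Dh p I (-v) * ∑ x : ZMod p, g x * ee p (v * x) := by
    have : ∑ x ∈ I, g x = ∑ x : ZMod p, g x * (if x ∈ I then (1 : ℂ) else 0) := by
      simp [Finset.sum_ite_mem]
    rw [this]
    simp only [indicator_expand]
    simp only [Finset.mul_sum]
    rw [Finset.sum_comm]
    refine Finset.sum_congr rfl fun v _ => Finset.sum_congr rfl fun x _ => ?_
    ring
  rw [h1, norm_mul]
  have h2 : ‖∑ v : ZMod p, Dh p I (-v) * ∑ x : ZMod p, g x * ee p (v * x)‖ ≤ (L * p) * M := by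
    refine (norm_sum_le _ _).trans ?_
    refine le_trans ?_ (mul_le_mul_of_nonneg_right hL hM)
    rw [← Dh_neg_L1, Finset.sum_mul]
    refine Finset.sum_le_sum fun v _ => ?_
    rw [norm_mul]
    exact mul_le_mul_of_nonneg_left (hg v) (norm_nonneg _)
  have h3 : ‖(1 / p : ℂ)‖ = 1 / p := by simp
  rw [h3]
  calc _ ≤ (1 / p : ℝ) * (L * p * M) := by gcongr
    _ = L * M := by field_simp

lemma completed_weil (I : Finset (ZMod p)) (L : ℝ) (hL : ∑ v : ZMod p, ‖Dh p I v‖ ≤ L * p) (f : (ZMod p)[X]) (d : ℕ)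
    (h2 : 2 ≤ f.natDegree) (hd : f.natDegree ≤ d) (hdp : d < p) :
    ‖∑ x ∈ I, ee p (f.eval x)‖ ≤ L * (d * Real.sqrt p) := by
  refine completion p I L _ hL (by positivity) _ ?_
  intro v
  have h3 : (C v * X).natDegree < f.natDegree := lt_of_le_of_lt ((natDegree_C_mul_le v X).trans natDegree_X_le) (by omega)
  have h4 : (f + C v * X).natDegree = f.natDegree := natDegree_add_eq_left_of_natDegree_lt h3
  have h5 := weil p (ee p) (by
    intro h
    apply ee_ne_one p 1 one_ne_zero
    rw [h]; rfl) (f + C v * X) f.natDegree h4 (by omega) (by omega)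
  have h6 : ∀ x, ee p ((f + C v * X).eval x) = ee p (f.eval x) * ee p (v * x) := by
    intro x; rw [← AddChar.map_add_eq_mul]; simp
  simp only [h6] at h5
  refine h5.trans ?_
  gcongr

end D1
end CWS


namespace CWS
open scoped Classical

section D2

lemma sum_box_succ {R M : Type*} [AddCommMonoid M] {m : ℕ} (I : Fin (m+1) → Finset R) (g : (Fin (m+1) → R) → M) :
    ∑ x ∈ Fintype.piFinset I, g x =
      ∑ y ∈ Fintype.piFinset (Fin.tail I), ∑ x₀ ∈ I 0, g (Fin.cons x₀ y) := by
  rw [← Finset.sum_product' (f := fun y x₀ => g (Fin.cons x₀ y))]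
  refine Finset.sum_nbij' (fun x => (Fin.tail x, x 0)) (fun z => Fin.cons z.2 z.1) ?_ ?_ ?_ ?_ ?_
  · intro x hx
    rw [Fintype.mem_piFinset] at hx
    rw [Finset.mem_product, Fintype.mem_piFinset]
    exact ⟨fun i => hx i.succ, hx 0⟩
  · intro z hz
    rw [Finset.mem_product, Fintype.mem_piFinset] at hz
    rw [Fintype.mem_piFinset]
    intro i
    refine Fin.cases ?_ (fun i => ?_) i
    · simpa using hz.2
    · rw [Fin.cons_succ]; exact hz.1 i
  · intro x _; simp
  · intro z _; simp
  · intro x _; simp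

lemma card_box_le {R : Type*} {m : ℕ} (I : Fin m → Finset R) (H : ℝ)
    (hI : ∀ i, ((I i).card : ℝ) ≤ H) : ((Fintype.piFinset I).card : ℝ) ≤ H ^ m := by
  rw [Fintype.card_piFinset, Nat.cast_prod]
  calc _ ≤ ∏ _i : Fin m, H := Finset.prod_le_prod (fun _ _ => Nat.cast_nonneg _) fun i _ => hI i
    _ = _ := by simp

lemma zero_count {R : Type*} [CommRing R] [IsDomain R] {m : ℕ} (F : MvPolynomial (Fin m) R) (hF : F ≠ 0)
    (d : ℕ) (hd : F.totalDegree ≤ d) (I : Fin m → Finset R) (H : ℝ) (hH : 0 ≤ H)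
    (hI : ∀ i, ((I i).card : ℝ) ≤ H) :
    (((Fintype.piFinset I).filter (fun x => MvPolynomial.eval x F = 0)).card : ℝ) * H ≤ d * m * H ^ m := by
  induction m with
  | zero =>
    have : ((Fintype.piFinset I).filter (fun x => MvPolynomial.eval x F = 0)) = ∅ := by
      rw [Finset.filter_eq_empty_iff]
      intro x _ h
      apply hF
      rw [MvPolynomial.eq_C_of_isEmpty F] at h ⊢
      rw [MvPolynomial.eval_C] at h
      rw [h, map_zero]
    rw [this]; simp
  | succ m ih =>
    set f := MvPolynomial.finSuccEquiv R m F with hf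
    have hf0 : f ≠ 0 := by
      rw [hf]; simpa using hF
    have hlc : f.coeff f.natDegree ≠ 0 := Polynomial.leadingCoeff_ne_zero.2 hf0
    have hdeg := MvPolynomial.totalDegree_coeff_finSuccEquiv_add_le F f.natDegree hlc
    have ih' := ih (f.coeff f.natDegree) hlc (by rw [← hf] at hdeg; omega) (Fin.tail I) (fun i => hI _)
    set Bad := (Fintype.piFinset (Fin.tail I)).filter (fun x => MvPolynomial.eval x (f.coeff f.natDegree) = 0)
    have h1 : (((Fintype.piFinset I).filter (fun x => MvPolynomial.eval x F = 0)).card : ℝ) =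
        ∑ y ∈ Fintype.piFinset (Fin.tail I), (((I 0).filter (fun x₀ => MvPolynomial.eval (Fin.cons x₀ y : Fin (m+1) → R) F = 0)).card : ℝ) := by
      simp only [Finset.card_filter, Nat.cast_sum, Nat.cast_ite, Nat.cast_one, Nat.cast_zero]
      exact sum_box_succ I (fun x => if MvPolynomial.eval x F = 0 then (1 : ℝ) else 0)
    have h2 : ∀ y ∈ Fintype.piFinset (Fin.tail I), (((I 0).filter (fun x₀ => MvPolynomial.eval (Fin.cons x₀ y : Fin (m+1) → R) F = 0)).card : ℝ)
        ≤ (if MvPolynomial.eval y (f.coeff f.natDegree) = 0 then H else 0) + d := by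
      intro y _
      split_ifs with h
      · have : (((I 0).filter (fun x₀ => MvPolynomial.eval (Fin.cons x₀ y : Fin (m+1) → R) F = 0)).card : ℝ) ≤ H :=
          le_trans (by exact_mod_cast Finset.card_filter_le _ _) (hI 0)
        have : (0 : ℝ) ≤ d := Nat.cast_nonneg d
        linarith
      · rw [zero_add]
        have hq0 : f.map (MvPolynomial.eval y) ≠ 0 := by
          intro h0
          apply h
          have := congrArg (fun q => Polynomial.coeff q f.natDegree) h0
          simpa using this
        have : ((I 0).filter (fun x₀ => MvPolynomial.eval (Fin.cons x₀ y : Fin (m+1) → R) F = 0)) ⊆ (f.map (MvPolynomial.eval y)).roots.toFinset := by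
          intro x hx
          rw [Multiset.mem_toFinset, Polynomial.mem_roots hq0, Polynomial.IsRoot.def, ← MvPolynomial.eval_eq_eval_mv_eval']
          exact (Finset.mem_filter.1 hx).2
        have h3 := (Finset.card_le_card this).trans ((Multiset.toFinset_card_le _).trans (Polynomial.card_roots' _))
        have h4 := Polynomial.natDegree_map_le (f := MvPolynomial.eval y) (p := f)
        exact_mod_cast h3.trans (h4.trans (by rw [← hf] at hdeg; omega))
    have h3 := Finset.sum_le_sum h2
    rw [← h1, Finset.sum_add_distrib, Finset.sum_const, nsmul_eq_mul, ← Finset.sum_filter, Finset.sum_const, nsmul_eq_mul] at h3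
    have h4 := card_box_le (Fin.tail I) H (fun i => hI _)
    have h5 : ((Fintype.piFinset (Fin.tail I)).card : ℝ) * d ≤ H ^ m * d := by gcongr
    calc _ ≤ ((Bad.card : ℝ) * H + H ^ m * d) * H := by
          apply mul_le_mul_of_nonneg_right _ hH
          linarith
      _ ≤ (d * m * H ^ m + H ^ m * d) * H := by gcongr
      _ = _ := by push_cast; ring

lemma finSucc_rename {R : Type*} [CommRing R] {m : ℕ} (B : MvPolynomial (Fin m) R) :
    MvPolynomial.finSuccEquiv R m (MvPolynomial.rename Fin.succ B) = Polynomial.C B := by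
  induction B using MvPolynomial.induction_on with
  | C a => 
    rw [MvPolynomial.rename_C]
    simp [MvPolynomial.finSuccEquiv_apply]
  | add p q hp hq => simp [hp, hq]
  | mul_X p i hp => rw [map_mul, map_mul, hp, MvPolynomial.rename_X, MvPolynomial.finSuccEquiv_X_succ, map_mul]

lemma eq_of_deg_le_one {R : Type*} [CommRing R] {m : ℕ} (F : MvPolynomial (Fin (m+1)) R)
    (h : (MvPolynomial.finSuccEquiv R m F).natDegree ≤ 1) :
    F = MvPolynomial.rename Fin.succ ((MvPolynomial.finSuccEquiv R m F).coeff 1) * MvPolynomial.X 0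
      + MvPolynomial.rename Fin.succ ((MvPolynomial.finSuccEquiv R m F).coeff 0) := by
  apply (MvPolynomial.finSuccEquiv R m).injective
  rw [map_add, map_mul, finSucc_rename, finSucc_rename, MvPolynomial.finSuccEquiv_X_zero]
  exact Polynomial.eq_X_add_C_of_natDegree_le_one h

lemma eval_of_deg_le_one {R : Type*} [CommRing R] {m : ℕ} (F : MvPolynomial (Fin (m+1)) R)
    (h : (MvPolynomial.finSuccEquiv R m F).natDegree ≤ 1) (x : R) (y : Fin m → R) :
    MvPolynomial.eval (Fin.cons x y : Fin (m+1) → R) F =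
      MvPolynomial.eval y ((MvPolynomial.finSuccEquiv R m F).coeff 1) * x
        + MvPolynomial.eval y ((MvPolynomial.finSuccEquiv R m F).coeff 0) := by
  rw [MvPolynomial.eval_eq_eval_mv_eval']
  conv_lhs => rw [Polynomial.eq_X_add_C_of_natDegree_le_one h]
  simp

lemma coeff_totalDegree_le {R : Type*} [CommRing R] {m : ℕ} (F : MvPolynomial (Fin (m+1)) R) (k : ℕ) :
    ((MvPolynomial.finSuccEquiv R m F).coeff k).totalDegree ≤ F.totalDegree := by
  by_cases h : (MvPolynomial.finSuccEquiv R m F).coeff k = 0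
  · rw [h]; simp
  · have := MvPolynomial.totalDegree_coeff_finSuccEquiv_add_le F k h
    omega

lemma natDegree_finSucc_le {R : Type*} [CommRing R] {m : ℕ} (F : MvPolynomial (Fin (m+1)) R) :
    (MvPolynomial.finSuccEquiv R m F).natDegree ≤ F.totalDegree := by
  rw [MvPolynomial.natDegree_finSuccEquiv]; exact MvPolynomial.degreeOf_le_totalDegree _ _

variable (p : ℕ) [hp : Fact p.Prime]

/-- sum over a fibre polynomial -/
lemma sum_norm_poly (I : Finset (ZMod p)) (q : Polynomial (ZMod p)) (d : ℕ) (h1 : 1 ≤ q.natDegree) (hd : q.natDegree ≤ d)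
    (I0 : Finset (ZMod p)) : ∑ x ∈ I0, ‖Dh p I (q.eval x)‖ ≤ d * ∑ v : ZMod p, ‖Dh p I v‖ := by
  calc ∑ x ∈ I0, ‖Dh p I (q.eval x)‖ ≤ ∑ x : ZMod p, ‖Dh p I (q.eval x)‖ :=
        Finset.sum_le_sum_of_subset_of_nonneg (Finset.subset_univ _) (fun _ _ _ => norm_nonneg _)
    _ = ∑ v : ZMod p, ∑ x ∈ Finset.univ.filter (fun x => q.eval x = v), ‖Dh p I (q.eval x)‖ :=
        (Finset.sum_fiberwise _ _ _).symm
    _ ≤ ∑ v : ZMod p, d * ‖Dh p I v‖ := by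
        refine Finset.sum_le_sum fun v _ => ?_
        rw [Finset.sum_congr rfl (g := fun _ => ‖Dh p I v‖) (fun x hx => by rw [(Finset.mem_filter.1 hx).2]),
          Finset.sum_const, nsmul_eq_mul]
        apply mul_le_mul_of_nonneg_right _ (norm_nonneg _)
        have hne : (q - Polynomial.C v).natDegree = q.natDegree := Polynomial.natDegree_sub_C
        have h0 : q - Polynomial.C v ≠ 0 := by intro h; rw [h] at hne; simp at hne; omega
        have : Finset.univ.filter (fun x => q.eval x = v) ⊆ (q - Polynomial.C v).roots.toFinset := by
          intro x hx
          rw [Multiset.mem_toFinset, Polynomial.mem_roots h0, Polynomial.IsRoot.def]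
          simp [(Finset.mem_filter.1 hx).2]
        have h3 := (Finset.card_le_card this).trans ((Multiset.toFinset_card_le _).trans (Polynomial.card_roots' _))
        exact_mod_cast h3.trans (by omega)
    _ = _ := by rw [Finset.mul_sum]

lemma Q_bound (d : ℕ) (H L : ℝ) (hH : Real.sqrt p ≤ H) (hL1 : 1 ≤ L) (I : Finset (ZMod p)) (hI : (I.card : ℝ) ≤ H)
    (hL : ∑ v : ZMod p, ‖Dh p I v‖ ≤ L * p) :
    ∀ (m : ℕ) (A : MvPolynomial (Fin m) (ZMod p)), 1 ≤ A.totalDegree → A.totalDegree ≤ d →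
      ∀ (J : Fin m → Finset (ZMod p)), (∀ i, ((J i).card : ℝ) ≤ H) →
      ∑ y ∈ Fintype.piFinset J, ‖Dh p I (MvPolynomial.eval y A)‖ ≤ d * m * H ^ m * Real.sqrt p * L := by
  have hp1 : (1 : ℝ) ≤ p := by exact_mod_cast hp.out.pos
  have hs1 : 1 ≤ Real.sqrt p := Real.one_le_sqrt.2 hp1
  have hss : Real.sqrt p * Real.sqrt p = p := Real.mul_self_sqrt (by linarith)
  have hH0 : 0 ≤ H := by linarith
  have hDH : ∀ v, ‖Dh p I v‖ ≤ H := fun v => (Dh_le_card p I v).trans hI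
  intro m
  induction m with
  | zero =>
    intro A h1
    rw [MvPolynomial.eq_C_of_isEmpty A, MvPolynomial.totalDegree_C] at h1
    omega
  | succ m ih =>
    intro A h1 hd J hJ
    set f := MvPolynomial.finSuccEquiv (ZMod p) m A with hf
    have hfd : f.natDegree ≤ d := (natDegree_finSucc_le A).trans hd
    rcases Nat.eq_zero_or_pos f.natDegree with h0 | hpos
    · have hc1 : f.coeff 1 = 0 := Polynomial.coeff_eq_zero_of_natDegree_lt (by omega)
      have hA := eq_of_deg_le_one A (by rw [← hf]; omega)
      rw [← hf, hc1, map_zero, zero_mul, zero_add] at hA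
      have hdeg : 1 ≤ (f.coeff 0).totalDegree := by
        refine h1.trans ?_
        conv_lhs => rw [hA]
        exact MvPolynomial.totalDegree_rename_le _ _
      have hh := ih (f.coeff 0) hdeg ((coeff_totalDegree_le A 0).trans hd) (Fin.tail J) (fun i => hJ _)
      rw [sum_box_succ]
      have : ∀ y x, MvPolynomial.eval (Fin.cons x y : Fin (m+1) → ZMod p) A = MvPolynomial.eval y (f.coeff 0) := by
        intro y x
        rw [eval_of_deg_le_one A (by rw [← hf]; omega), ← hf, hc1]; simp
      simp only [this, Finset.sum_const, nsmul_eq_mul]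
      rw [← Finset.mul_sum]
      calc _ ≤ H * (d * m * H ^ m * Real.sqrt p * L) := mul_le_mul (hJ 0) hh (Finset.sum_nonneg fun _ _ => norm_nonneg _) hH0
        _ = d * m * (H ^ (m+1) * Real.sqrt p * L) := by ring
        _ ≤ d * (m+1) * (H ^ (m+1) * Real.sqrt p * L) := by gcongr; linarith
        _ = _ := by push_cast; ring
    · have hlc : f.coeff f.natDegree ≠ 0 := Polynomial.leadingCoeff_ne_zero.2 (by
        intro h; rw [h] at hpos; simp at hpos)
      have hz := zero_count (f.coeff f.natDegree) hlc d ((coeff_totalDegree_le A _).trans hd) (Fin.tail J) H hH0 (fun i => hJ _)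
      rw [sum_box_succ]
      have h2 : ∀ y ∈ Fintype.piFinset (Fin.tail J), ∑ x ∈ J 0, ‖Dh p I (MvPolynomial.eval (Fin.cons x y : Fin (m+1) → ZMod p) A)‖
          ≤ (if MvPolynomial.eval y (f.coeff f.natDegree) = 0 then H * H else 0) + d * (L * p) := by
        intro y _
        split_ifs with h
        · have : ∑ x ∈ J 0, ‖Dh p I (MvPolynomial.eval (Fin.cons x y : Fin (m+1) → ZMod p) A)‖ ≤ (J 0).card * H := by
            refine (Finset.sum_le_sum fun x _ => hDH _).trans ?_
            simp
          have h3 : ((J 0).card : ℝ) * H ≤ H * H := by gcongr; exact hJ 0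
          have : 0 ≤ d * (L * p) := by positivity
          linarith
        · rw [zero_add]
          simp only [MvPolynomial.eval_eq_eval_mv_eval']
          have hnd : (f.map (MvPolynomial.eval y)).natDegree = f.natDegree :=
            Polynomial.natDegree_map_of_leadingCoeff_ne_zero _ h
          refine (sum_norm_poly p I (f.map (MvPolynomial.eval y)) d (by omega) (by omega) (J 0)).trans ?_
          gcongr
      refine (Finset.sum_le_sum h2).trans ?_
      rw [Finset.sum_add_distrib, Finset.sum_const, nsmul_eq_mul, ← Finset.sum_filter, Finset.sum_const, nsmul_eq_mul]
      have h4 := card_box_le (Fin.tail J) H (fun i => hJ _)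
      calc _ ≤ (d * m * H ^ m) * H + H ^ m * (d * (L * (H * Real.sqrt p))) := by
            rw [← mul_assoc]
            have : (p : ℝ) ≤ H * Real.sqrt p := by
              nlinarith
            exact add_le_add (mul_le_mul_of_nonneg_right (le_trans (le_of_eq (by congr!)) hz) hH0) (by gcongr)
        _ ≤ (d * m * H ^ m) * H * (Real.sqrt p * L) + H ^ m * (d * (L * (H * Real.sqrt p))) := by
            have : 1 ≤ Real.sqrt p * L := one_le_mul_of_one_le_of_one_le hs1 hL1
            have h0 : 0 ≤ (d * m * H ^ m) * H := by positivity
            nlinarith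
        _ = _ := by push_cast; ring

lemma P_bound (d : ℕ) (hdp : d < p) (H L : ℝ) (hH : Real.sqrt p ≤ H) (hL1 : 1 ≤ L)  :
    ∀ (m : ℕ) (F : MvPolynomial (Fin m) (ZMod p)), 2 ≤ F.totalDegree → F.totalDegree ≤ d →
      ∀ (J : Fin m → Finset (ZMod p)), (∀ i, ((J i).card : ℝ) ≤ H) →
        (∀ i, ∑ v : ZMod p, ‖Dh p (J i) v‖ ≤ L * p) →
      ‖∑ x ∈ Fintype.piFinset J, ee p (MvPolynomial.eval x F)‖ * H ≤ d * m * H ^ m * Real.sqrt p * L := by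
  have hp1 : (1 : ℝ) ≤ p := by exact_mod_cast hp.out.pos
  have hs1 : 1 ≤ Real.sqrt p := Real.one_le_sqrt.2 hp1
  have hH0 : 0 ≤ H := by linarith
  intro m
  induction m with
  | zero =>
    intro A h1
    rw [MvPolynomial.eq_C_of_isEmpty A, MvPolynomial.totalDegree_C] at h1
    omega
  | succ m ih =>
    intro A h1 hd J hJ hJL
    set f := MvPolynomial.finSuccEquiv (ZMod p) m A with hf
    have hfd : f.natDegree ≤ d := (natDegree_finSucc_le A).trans hd
    rw [sum_box_succ]
    rcases Nat.lt_or_ge 1 f.natDegree with hpos | h0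
    · have hlc : f.coeff f.natDegree ≠ 0 := Polynomial.leadingCoeff_ne_zero.2 (by
        intro h; rw [h] at hpos; simp at hpos)
      have hz := zero_count (f.coeff f.natDegree) hlc d ((coeff_totalDegree_le A _).trans hd) (Fin.tail J) H hH0 (fun i => hJ _)
      have h2 : ∀ y ∈ Fintype.piFinset (Fin.tail J), ‖∑ x ∈ J 0, ee p (MvPolynomial.eval (Fin.cons x y : Fin (m+1) → ZMod p) A)‖
          ≤ (if MvPolynomial.eval y (f.coeff f.natDegree) = 0 then H else 0) + L * (d * Real.sqrt p) := by
        intro y _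
        split_ifs with h
        · have : ‖∑ x ∈ J 0, ee p (MvPolynomial.eval (Fin.cons x y : Fin (m+1) → ZMod p) A)‖ ≤ (J 0).card := by
            refine (norm_sum_le _ _).trans ?_
            simp
          have h3 := hJ 0
          have : 0 ≤ L * (d * Real.sqrt p) := by positivity
          linarith
        · rw [zero_add]
          simp only [MvPolynomial.eval_eq_eval_mv_eval']
          have hnd : (f.map (MvPolynomial.eval y)).natDegree = f.natDegree :=
            Polynomial.natDegree_map_of_leadingCoeff_ne_zero _ h
          exact completed_weil p (J 0) L (hJL 0) _ d (by rw [hnd]; omega) (by rw [hnd]; omega) hdp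
      have h3 := (norm_sum_le _ _).trans (Finset.sum_le_sum h2)
      rw [Finset.sum_add_distrib, Finset.sum_const, nsmul_eq_mul, ← Finset.sum_filter, Finset.sum_const, nsmul_eq_mul] at h3
      have h4 := card_box_le (Fin.tail J) H (fun i => hJ _)
      calc _ ≤ ((d * m * H ^ m) + H ^ m * (L * (d * Real.sqrt p))) * H := by
            apply mul_le_mul_of_nonneg_right _ hH0
            refine h3.trans ?_
            exact add_le_add (le_trans (le_of_eq (by congr!)) hz) (by gcongr)
        _ ≤ ((d * m * H ^ m) * (Real.sqrt p * L) + H ^ m * (L * (d * Real.sqrt p))) * H := by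
            apply mul_le_mul_of_nonneg_right _ hH0
            have : 1 ≤ Real.sqrt p * L := one_le_mul_of_one_le_of_one_le hs1 hL1
            have h0 : 0 ≤ (d * m * H ^ m) := by positivity
            nlinarith
        _ = _ := by push_cast; ring
    · have hev : ∀ y, ∑ x ∈ J 0, ee p (MvPolynomial.eval (Fin.cons x y : Fin (m+1) → ZMod p) A)
          = Dh p (J 0) (MvPolynomial.eval y (f.coeff 1)) * ee p (MvPolynomial.eval y (f.coeff 0)) := by
        intro y
        rw [Dh, Finset.sum_mul]
        refine Finset.sum_congr rfl fun x _ => ?_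
        rw [eval_of_deg_le_one A h0, AddChar.map_add_eq_mul]
      simp only [hev]
      rcases Nat.eq_zero_or_pos (f.coeff 1).totalDegree with hA0 | hA1
      · have hAc := (MvPolynomial.totalDegree_eq_zero_iff_eq_C).1 hA0
        set a := (f.coeff 1).coeff 0
        have hA := eq_of_deg_le_one A h0
        rw [← hf, hAc] at hA
        have hB : 2 ≤ (f.coeff 0).totalDegree := by
          by_contra! hlt
          have : A.totalDegree ≤ 1 := by
            rw [hA]
            refine (MvPolynomial.totalDegree_add _ _).trans (max_le ?_ ?_)
            · refine (MvPolynomial.totalDegree_mul _ _).trans ?_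
              rw [MvPolynomial.rename_C, MvPolynomial.totalDegree_C, MvPolynomial.totalDegree_X]
            · exact (MvPolynomial.totalDegree_rename_le _ _).trans (by omega)
          omega
        have hh := ih (f.coeff 0) hB ((coeff_totalDegree_le A 0).trans hd) (Fin.tail J) (fun i => hJ _) (fun i => hJL _)
        have : ∀ y, MvPolynomial.eval y (f.coeff 1) = a := by intro y; rw [hAc]; simp
        simp only [this]
        rw [← Finset.mul_sum, norm_mul, mul_assoc]
        calc _ ≤ H * (d * m * H ^ m * Real.sqrt p * L) := mul_le_mul ((Dh_le_card p _ _).trans (hJ 0)) hh (by positivity) hH0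
          _ = d * m * (H ^ (m+1) * Real.sqrt p * L) := by ring
          _ ≤ d * (m+1) * (H ^ (m+1) * Real.sqrt p * L) := by gcongr; linarith
          _ = _ := by push_cast; ring
      · have hq := Q_bound p d H L hH hL1 (J 0) (hJ 0) (hJL 0) m (f.coeff 1) hA1 ((coeff_totalDegree_le A 1).trans hd) (Fin.tail J) (fun i => hJ _)
        have h3 : ‖∑ y ∈ Fintype.piFinset (Fin.tail J), Dh p (J 0) (MvPolynomial.eval y (f.coeff 1)) * ee p (MvPolynomial.eval y (f.coeff 0))‖ ≤ d * m * H ^ m * Real.sqrt p * L := by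
          refine (norm_sum_le _ _).trans (le_trans (le_of_eq ?_) hq)
          refine Finset.sum_congr rfl fun y _ => ?_
          rw [norm_mul, ee_norm, mul_one]
        calc _ ≤ (d * m * H ^ m * Real.sqrt p * L) * H := by gcongr
          _ = d * m * (H ^ (m+1) * Real.sqrt p * L) := by ring
          _ ≤ d * (m+1) * (H ^ (m+1) * Real.sqrt p * L) := by gcongr; linarith
          _ = _ := by push_cast; ring

end D2
end CWS


namespace CWS
open scoped Classical

section D3

lemma prod_sub_prod_le {ι : Type*} (s : Finset ι) (a b : ι → ℝ) (ha : ∀ i, 0 ≤ a i ∧ a i ≤ 1)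
    (hb : ∀ i, 0 ≤ b i ∧ b i ≤ 1) : |∏ i ∈ s, a i - ∏ i ∈ s, b i| ≤ ∑ i ∈ s, |a i - b i| := by
  induction s using Finset.induction_on with
  | empty => simp
  | insert i s hi ih =>
    rw [Finset.prod_insert hi, Finset.prod_insert hi, Finset.sum_insert hi]
    have h1 : 0 ≤ ∏ i ∈ s, a i := Finset.prod_nonneg fun i _ => (ha i).1
    have h2 : ∏ i ∈ s, a i ≤ 1 := Finset.prod_le_one (fun i _ => (ha i).1) fun i _ => (ha i).2
    calc |a i * ∏ i ∈ s, a i - b i * ∏ i ∈ s, b i|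
        = |(a i - b i) * ∏ i ∈ s, a i + b i * (∏ i ∈ s, a i - ∏ i ∈ s, b i)| := by congr 1; ring
      _ ≤ |(a i - b i) * ∏ i ∈ s, a i| + |b i * (∏ i ∈ s, a i - ∏ i ∈ s, b i)| := abs_add_le _ _
      _ ≤ _ := by
        rw [abs_mul, abs_mul, abs_of_nonneg h1, abs_of_nonneg (hb i).1]
        have := (hb i).1
        have := (hb i).2
        have h3 := abs_nonneg (a i - b i)
        have h4 := abs_nonneg (∏ i ∈ s, a i - ∏ i ∈ s, b i)
        nlinarith

variable (p : ℕ) [hp : Fact p.Prime]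

lemma ee_sum {ι : Type*} (s : Finset ι) (g : ι → ZMod p) : ee p (∑ i ∈ s, g i) = ∏ i ∈ s, ee p (g i) := by
  induction s using Finset.induction_on with
  | empty => simp
  | insert i s hi ih => rw [Finset.sum_insert hi, Finset.prod_insert hi, AddChar.map_add_eq_mul, ih]

lemma fourier_count {m n : ℕ} (G : Fin n → MvPolynomial (Fin m) (ZMod p)) (X : Finset (Fin m → ZMod p))
    (J : Fin n → Finset (ZMod p)) (L M : ℝ) (hM0 : 0 ≤ M)
    (hJ : ∀ j, ∑ v : ZMod p, ‖Dh p (J j) v‖ ≤ L * p)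
    (hM : ∀ a : Fin n → ZMod p, a ≠ 0 → ‖∑ x ∈ X, ee p (MvPolynomial.eval x (∑ j, a j • G j))‖ ≤ M) :
    |((X.filter (fun x => ∀ j, MvPolynomial.eval x (G j) ∈ J j)).card : ℝ)
      - (∏ j, ((J j).card : ℝ) / p) * X.card| ≤ L ^ n * M := by
  have hp0 : (0 : ℝ) < p := by exact_mod_cast hp.out.pos
  set W : (Fin n → ZMod p) → ℂ := fun a => ∏ j, ((1 / p) * Dh p (J j) (-a j)) with hW
  have h1 : ((X.filter (fun x => ∀ j, MvPolynomial.eval x (G j) ∈ J j)).card : ℂ)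
      = ∑ a : Fin n → ZMod p, W a * ∑ x ∈ X, ee p (MvPolynomial.eval x (∑ j, a j • G j)) := by
    have e1 : ((X.filter (fun x => ∀ j, MvPolynomial.eval x (G j) ∈ J j)).card : ℂ)
      = ∑ x ∈ X, ∏ j, (if MvPolynomial.eval x (G j) ∈ J j then (1 : ℂ) else 0) := by
      rw [Finset.card_filter, Nat.cast_sum]
      refine Finset.sum_congr rfl fun x _ => ?_
      rw [Finset.prod_ite_zero]
      simp
    rw [e1]
    simp only [indicator_expand, Finset.mul_sum]
    simp only [Finset.prod_univ_sum, Fintype.piFinset_univ]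
    rw [Finset.sum_comm]
    refine Finset.sum_congr rfl fun a _ => ?_
    refine Finset.sum_congr rfl fun x _ => ?_
    simp only [← mul_assoc]
    rw [Finset.prod_mul_distrib, hW, map_sum, ee_sum]
    simp [MvPolynomial.smul_eval]
  have h2 : W 0 * ∑ x ∈ X, ee p (MvPolynomial.eval x (∑ j, (0 : Fin n → ZMod p) j • G j)) = (∏ j, ((J j).card : ℂ) / p) * X.card := by
    simp [hW, Dh, div_eq_inv_mul]
  rw [← Finset.add_sum_erase _ _ (Finset.mem_univ (0 : Fin n → ZMod p)), h2] at h1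
  have h3 : ‖∑ a ∈ Finset.univ.erase (0 : Fin n → ZMod p), W a * ∑ x ∈ X, ee p (MvPolynomial.eval x (∑ j, a j • G j))‖ ≤ L ^ n * M := by
    refine (norm_sum_le _ _).trans ?_
    have e1 : ∀ a ∈ Finset.univ.erase (0 : Fin n → ZMod p), ‖W a * ∑ x ∈ X, ee p (MvPolynomial.eval x (∑ j, a j • G j))‖ ≤ ‖W a‖ * M := by
      intro a ha
      rw [norm_mul]
      exact mul_le_mul_of_nonneg_left (hM a (Finset.mem_erase.1 ha).1) (norm_nonneg _)
    refine (Finset.sum_le_sum e1).trans ?_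
    rw [← Finset.sum_mul]
    apply mul_le_mul_of_nonneg_right _ hM0
    calc _ ≤ ∑ a : Fin n → ZMod p, ‖W a‖ := Finset.sum_le_sum_of_subset_of_nonneg (Finset.erase_subset _ _) (fun _ _ _ => norm_nonneg _)
      _ = ∏ j : Fin n, ∑ v : ZMod p, ‖(1 / p) * Dh p (J j) (-v)‖ := by
          rw [Finset.prod_univ_sum, Fintype.piFinset_univ]
          refine Finset.sum_congr rfl fun a _ => ?_
          rw [hW, norm_prod]
      _ ≤ ∏ j : Fin n, L := by
          refine Finset.prod_le_prod (fun _ _ => Finset.sum_nonneg fun _ _ => norm_nonneg _) fun j _ => ?_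
          simp only [norm_mul]
          rw [← Finset.mul_sum, Dh_neg_L1]
          have : ‖(1 / p : ℂ)‖ = 1 / p := by simp
          rw [this, one_div, inv_mul_le_iff₀ hp0, mul_comm]
          exact hJ j
      _ = L ^ n := by simp
  have h4 : ((((X.filter (fun x => ∀ j, MvPolynomial.eval x (G j) ∈ J j)).card : ℝ)
      - (∏ j, ((J j).card : ℝ) / p) * X.card : ℝ) : ℂ) = ∑ a ∈ Finset.univ.erase (0 : Fin n → ZMod p), W a * ∑ x ∈ X, ee p (MvPolynomial.eval x (∑ j, a j • G j)) := by
    push_cast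
    rw [h1]; ring
  rw [← h4, Complex.norm_real, Real.norm_eq_abs] at h3
  exact h3

lemma box_equi {m n d : ℕ} (hdp : d < p) (G : Fin n → MvPolynomial (Fin m) (ZMod p)) 
    (hG : ∀ j, (G j).totalDegree ≤ d) (hG2 : ∀ a : Fin n → ZMod p, a ≠ 0 → 2 ≤ (∑ j, a j • G j).totalDegree)
    (H L : ℝ) (hH : Real.sqrt p ≤ H) (hH2 : H ≤ 2 * p) (hL1 : 1 ≤ L) (hL4 : 4 * Real.log p ≤ L)
    (a b : Fin m → ℝ) (hab : ∀ i, a i ≤ b i ∧ b i ≤ 1) (hJ : ∀ i, ((Jv p (a i) (b i)).card : ℝ) ≤ H)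
    (α β : Fin n → ℝ) (hαβ : ∀ j, 0 ≤ α j ∧ α j ≤ β j ∧ β j ≤ 1) :
    |(((Fintype.piFinset fun i => Jv p (a i) (b i)).filter (fun x => ∀ j, MvPolynomial.eval x (G j) ∈ Jv p (α j) (β j))).card : ℝ)
      - (∏ j, (β j - α j)) * (Fintype.piFinset fun i => Jv p (a i) (b i)).card| * H ≤
      (d * m + 2 * n) * H ^ m * Real.sqrt p * L ^ (n + 1) := by
  have hp0 : (0 : ℝ) < p := by exact_mod_cast hp.out.pos
  have hp1 : (1 : ℝ) ≤ p := by exact_mod_cast hp.out.pos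
  have hs1 : 1 ≤ Real.sqrt p := Real.one_le_sqrt.2 hp1
  have hH0 : 0 < H := by linarith
  set X := Fintype.piFinset fun i => Jv p (a i) (b i) with hX
  set N := (X.filter (fun x => ∀ j, MvPolynomial.eval x (G j) ∈ Jv p (α j) (β j))).card
  have hLL : ∀ a b : ℝ, a ≤ b → b ≤ 1 → ∑ v : ZMod p, ‖Dh p (Jv p a b) v‖ ≤ L * p := by
    intro a b h1 h2
    refine (Dh_L1 p a b h1 h2).trans ?_
    gcongr
  have h1 := fourier_count p G X (fun j => Jv p (α j) (β j)) L (d * m * H ^ m * Real.sqrt p * L / H) (by positivity)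
    (fun j => hLL _ _ (hαβ j).2.1 (hαβ j).2.2) (by
      intro c hc
      rw [le_div_iff₀ hH0]
      refine P_bound p d hdp H L hH hL1 m _ (hG2 c hc) ?_ _ hJ (fun i => hLL _ _ (hab i).1 (hab i).2)
      refine (MvPolynomial.totalDegree_finset_sum _ _).trans ?_
      refine Finset.sup_le fun j _ => ?_
      exact (MvPolynomial.totalDegree_smul_le _ _).trans (hG j))
  have h2 : |∏ j, ((Jv p (α j) (β j)).card : ℝ) / p - ∏ j, (β j - α j)| ≤ n / p := by
    refine (prod_sub_prod_le _ _ _ ?_ ?_).trans ?_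
    · intro j
      refine ⟨by positivity, ?_⟩
      rw [div_le_one hp0]
      exact_mod_cast (Finset.card_le_univ _).trans (by rw [ZMod.card])
    · intro j
      obtain ⟨x, y, z⟩ := hαβ j
      constructor <;> linarith
    · calc _ ≤ ∑ j : Fin n, (1 / p : ℝ) := by
            refine Finset.sum_le_sum fun j _ => ?_
            obtain ⟨x, y, z⟩ := hαβ j
            have := card_Jv p (α j) (β j) x y z
            rw [show ((Jv p (α j) (β j)).card : ℝ) / p - (β j - α j) = (((Jv p (α j) (β j)).card : ℝ) - (β j - α j) * p) / p by field_simp, abs_div, abs_of_pos hp0]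
            gcongr
        _ = n / p := by simp [div_eq_mul_inv]
  have h3 : (X.card : ℝ) ≤ H ^ m := card_box_le _ H hJ
  have h4 : |(N : ℝ) - (∏ j, (β j - α j)) * X.card| ≤ L ^ n * (d * m * H ^ m * Real.sqrt p * L / H) + n / p * H ^ m := by
    calc |(N : ℝ) - (∏ j, (β j - α j)) * X.card|
        = |((N : ℝ) - (∏ j, ((Jv p (α j) (β j)).card : ℝ) / p) * X.card) + (∏ j, ((Jv p (α j) (β j)).card : ℝ) / p - ∏ j, (β j - α j)) * X.card| := by congr 1; ring
      _ ≤ _ := (abs_add_le _ _)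
      _ ≤ _ := by
        refine add_le_add h1 ?_
        rw [abs_mul, Nat.abs_cast]
        gcongr
  have h5 : (n : ℝ) / p * H ^ m * H ≤ 2 * n * H ^ m * Real.sqrt p * L ^ (n + 1) := by
    calc (n : ℝ) / p * H ^ m * H ≤ (n : ℝ) / p * H ^ m * (2 * p) := by gcongr
      _ = 2 * n * H ^ m * 1 * 1 := by field_simp
      _ ≤ _ := by gcongr; exact one_le_pow₀ hL1
  calc _ ≤ (L ^ n * (d * m * H ^ m * Real.sqrt p * L / H) + n / p * H ^ m) * H := by gcongr
    _ = d * m * H ^ m * Real.sqrt p * L ^ (n + 1) + n / p * H ^ m * H := by field_simp; ring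
    _ ≤ _ := by linarith

end D3
end CWS

namespace CWS
open scoped Classical
section

noncomputable def rr (t : AddCircle (1:ℝ)) : ℝ := (AddCircle.equivIco (1:ℝ) 0 t : ℝ)

lemma rr_mem (t : AddCircle (1:ℝ)) : 0 ≤ rr t ∧ rr t < 1 := by
  have := (AddCircle.equivIco (1:ℝ) 0 t).2
  exact ⟨this.1, by have h := this.2; unfold rr; linarith⟩

lemma rr_coe (x : ℝ) (h0 : 0 ≤ x) (h1 : x < 1) : rr (x : AddCircle (1:ℝ)) = x := by
  unfold rr
  rw [AddCircle.coe_equivIco_mk_apply, div_one, mul_one]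
  exact Int.fract_eq_self.2 ⟨h0, h1⟩

lemma coe_rr (t : AddCircle (1:ℝ)) : ((rr t : ℝ) : AddCircle (1:ℝ)) = t :=
  AddCircle.coe_equivIco

lemma rr_measurable : Measurable rr :=
  measurable_subtype_coe.comp (AddCircle.measurableEquivIco (1:ℝ) 0).measurable

lemma dist_le_rr (s t : AddCircle (1:ℝ)) : dist s t ≤ |rr s - rr t| := by
  rw [dist_eq_norm]
  conv_lhs => rw [← coe_rr s, ← coe_rr t]
  exact QuotientAddGroup.norm_mk_le_norm (S := AddSubgroup.zmultiples (1:ℝ)) (m := rr s - rr t)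

lemma arc_vol (K j : ℕ) (hK : 0 < K) (hj : j < K) :
    MeasureTheory.volume {a : AddCircle (1:ℝ) | ⌊(K:ℝ) * rr a⌋₊ = j} = ENNReal.ofReal (1/K) := by
  have hms : MeasurableSet {a : AddCircle (1:ℝ) | ⌊(K:ℝ) * rr a⌋₊ = j} := by
    have : Measurable fun a : AddCircle (1:ℝ) => ⌊(K:ℝ) * rr a⌋₊ :=
      Nat.measurable_floor.comp (rr_measurable.const_mul _)
    exact this (measurableSet_singleton j)
  have hmp := AddCircle.measurePreserving_mk (1:ℝ) 0
  have hK' : (0:ℝ) < K := by exact_mod_cast hK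
  rw [← hmp.measure_preimage hms.nullMeasurableSet, zero_add,
    ← MeasureTheory.restrict_Ico_eq_restrict_Ioc, MeasureTheory.Measure.restrict_apply (hmp.measurable hms)]
  have : (QuotientAddGroup.mk ⁻¹' {a : AddCircle (1:ℝ) | ⌊(K:ℝ) * rr a⌋₊ = j}) ∩ Set.Ico (0:ℝ) 1
      = Set.Ico ((j:ℝ)/K) ((j+1)/K) := by
    ext x
    constructor
    · rintro ⟨hx, hx0, hx1⟩
      have hx : ⌊(K:ℝ) * rr (x : AddCircle (1:ℝ))⌋₊ = j := hx
      rw [rr_coe x hx0 hx1, Nat.floor_eq_iff (by positivity)] at hx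
      constructor
      · rw [div_le_iff₀ hK']; linarith
      · rw [lt_div_iff₀ hK']; linarith
    · rintro ⟨h1, h2⟩
      rw [div_le_iff₀ hK'] at h1
      rw [lt_div_iff₀ hK'] at h2
      have hx0 : 0 ≤ x := by
        by_contra h
        have : (0:ℝ) ≤ j := by positivity
        nlinarith
      have hx1 : x < 1 := by
        have : (j:ℝ) + 1 ≤ K := by exact_mod_cast hj
        by_contra h
        nlinarith
      refine ⟨?_, hx0, hx1⟩
      show ⌊(K:ℝ) * rr (x : AddCircle (1:ℝ))⌋₊ = j
      rw [rr_coe x hx0 hx1, Nat.floor_eq_iff (by positivity)]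
      constructor <;> linarith
  rw [this, Real.volume_Ico]
  congr 1
  ring

noncomputable def idx (K : ℕ) {m : ℕ} (t : Torus m) : Fin m → ℕ := fun i => ⌊(K:ℝ) * rr (t i)⌋₊

def IS (m K : ℕ) : Finset (Fin m → ℕ) := Fintype.piFinset (fun _ => Finset.range K)

lemma idx_mem (K : ℕ) (hK : 0 < K) {m : ℕ} (t : Torus m) : idx K t ∈ IS m K := by
  rw [IS, Fintype.mem_piFinset]
  intro i
  rw [Finset.mem_range, idx, Nat.floor_lt (mul_nonneg (by positivity) (rr_mem _).1)]
  have := (rr_mem (t i)).2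
  have hK' : (0:ℝ) < K := by exact_mod_cast hK
  nlinarith

def cell (K : ℕ) {m : ℕ} (k : Fin m → ℕ) : Set (Torus m) := {t | idx K t = k}

lemma cell_meas (K : ℕ) {m : ℕ} (k : Fin m → ℕ) : MeasurableSet (cell K k) := by
  have : Measurable (idx K : Torus m → _) := by
    apply measurable_pi_lambda
    intro i
    exact Nat.measurable_floor.comp ((rr_measurable.comp (measurable_pi_apply i)).const_mul _)
  exact this (measurableSet_singleton k)

lemma cell_vol (K : ℕ) (hK : 0 < K) {m : ℕ} (k : Fin m → ℕ) (hk : k ∈ IS m K) :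
    MeasureTheory.volume (cell K k) = ENNReal.ofReal ((1/K)^m) := by
  have : cell K k = Set.pi Set.univ fun i => {a : AddCircle (1:ℝ) | ⌊(K:ℝ) * rr a⌋₊ = k i} := by
    ext t
    simp only [cell, idx, Set.mem_setOf_eq, Set.mem_pi, Set.mem_univ, true_implies, funext_iff]
  rw [this, MeasureTheory.volume_pi_pi]
  rw [Finset.prod_congr rfl (fun i _ => arc_vol K (k i) hK (by
    rw [IS, Fintype.mem_piFinset] at hk; simpa using hk i))]
  rw [Finset.prod_const, Finset.card_univ, Fintype.card_fin, ENNReal.ofReal_pow (by positivity)]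

lemma vol_univ (m : ℕ) : MeasureTheory.volume (Set.univ : Set (Torus m)) = 1 := by
  rw [← Set.pi_univ, MeasureTheory.volume_pi_pi]
  simp

lemma vol_ne_top {m : ℕ} (E : Set (Torus m)) : MeasureTheory.volume E ≠ ⊤ := by
  have := MeasureTheory.measure_mono (μ := MeasureTheory.volume) (Set.subset_univ E)
  rw [vol_univ] at this
  exact ne_top_of_le_ne_top (by simp) this

lemma tmeas_le_one {m : ℕ} (E : Set (Torus m)) : tmeas E ≤ 1 := by
  have := MeasureTheory.measure_mono (μ := MeasureTheory.volume) (Set.subset_univ E)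
  rw [vol_univ] at this
  exact ENNReal.toReal_le_of_le_ofReal (by norm_num) (by simpa using this)

lemma tmeas_nonneg {m : ℕ} (E : Set (Torus m)) : 0 ≤ tmeas E := ENNReal.toReal_nonneg

lemma vol_cells (K : ℕ) (hK : 0 < K) {m : ℕ} (T : Finset (Fin m → ℕ)) (hT : T ⊆ IS m K) :
    MeasureTheory.volume (⋃ k ∈ T, cell K k) = ENNReal.ofReal (T.card * (1/K)^m) := by
  rw [MeasureTheory.measure_biUnion_finset]
  · rw [Finset.sum_congr rfl (fun k hk => cell_vol K hK k (hT hk)), Finset.sum_const, nsmul_eq_mul,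
      ENNReal.ofReal_mul (by positivity), ENNReal.ofReal_natCast]
  · intro a _ b _ hab
    refine Set.disjoint_left.2 fun t h1 h2 => hab ?_
    exact h1.symm.trans h2
  · intro k _
    exact cell_meas K k

lemma cells_le (K : ℕ) (hK : 0 < K) {m : ℕ} (T : Finset (Fin m → ℕ)) (hT : T ⊆ IS m K)
    (E : Set (Torus m)) (h : ∀ k ∈ T, cell K k ⊆ E) : (T.card : ℝ) ≤ (K:ℝ)^m * tmeas E := by
  have h1 : MeasureTheory.volume (⋃ k ∈ T, cell K k) ≤ MeasureTheory.volume E :=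
    MeasureTheory.measure_mono (Set.iUnion₂_subset h)
  rw [vol_cells K hK T hT, ENNReal.ofReal_le_iff_le_toReal (vol_ne_top E)] at h1
  have hK' : (0:ℝ) < K := by exact_mod_cast hK
  rw [one_div, inv_pow, ← div_eq_mul_inv, div_le_iff₀ (by positivity)] at h1
  rw [mul_comm]; exact h1

lemma le_cells (K : ℕ) (hK : 0 < K) {m : ℕ} (T : Finset (Fin m → ℕ)) (hT : T ⊆ IS m K)
    (E : Set (Torus m)) (h : ∀ t ∈ E, idx K t ∈ T) : (K:ℝ)^m * tmeas E ≤ T.card := by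
  have h1 : MeasureTheory.volume E ≤ MeasureTheory.volume (⋃ k ∈ T, cell K k) := by
    apply MeasureTheory.measure_mono
    intro t ht
    exact Set.mem_iUnion₂.2 ⟨idx K t, h t ht, rfl⟩
  rw [vol_cells K hK T hT] at h1
  have h2 := ENNReal.toReal_le_of_le_ofReal (by positivity) h1
  have hK' : (0:ℝ) < K := by exact_mod_cast hK
  rw [one_div, inv_pow, ← div_eq_mul_inv, le_div_iff₀ (by positivity)] at h2
  rw [mul_comm]; exact h2

lemma torusDist_lt (K : ℕ) (hK : 0 < K) {m : ℕ} (s t : Torus m) (h : idx K s = idx K t) :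
    torusDist s t < (m+1)/K := by
  have hK' : (0:ℝ) < K := by exact_mod_cast hK
  have hd : ∀ i, dist (s i) (t i) ≤ 1/K := by
    intro i
    refine (dist_le_rr _ _).trans ?_
    have h1 := congrFun h i
    simp only [idx] at h1
    have hs := Nat.floor_le (mul_nonneg hK'.le (rr_mem (s i)).1)
    have hs' := Nat.lt_floor_add_one ((K:ℝ) * rr (s i))
    have ht := Nat.floor_le (mul_nonneg hK'.le (rr_mem (t i)).1)
    have ht' := Nat.lt_floor_add_one ((K:ℝ) * rr (t i))
    rw [h1] at hs hs'
    rw [le_div_iff₀ hK', ← abs_of_pos hK', ← abs_mul, abs_le]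
    constructor <;> nlinarith
  unfold torusDist
  rw [Real.sqrt_lt' (by positivity)]
  have : ∑ i, dist (s i) (t i) ^ 2 ≤ ∑ _i : Fin m, (1/(K:ℝ))^2 :=
    Finset.sum_le_sum fun i _ => pow_le_pow_left₀ dist_nonneg (hd i) 2
  refine this.trans_lt ?_
  rw [Finset.sum_const, Finset.card_univ, Fintype.card_fin, nsmul_eq_mul, div_pow, div_pow, mul_div_assoc', one_pow, mul_one]
  gcongr
  have : (0:ℝ) ≤ m := by positivity
  nlinarith

lemma torusDistSet_lt (K : ℕ) (hK : 0 < K) {m : ℕ} (s t : Torus m) (Ω : Set (Torus m))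
    (ht : t ∈ Ω) (h : idx K s = idx K t) : torusDistSet s Ω < (m+1)/K := by
  refine lt_of_le_of_lt ?_ (torusDist_lt K hK s t h)
  unfold torusDistSet
  refine ciInf_le (f := fun w : Ω => torusDist s (w : Torus m)) ?_ ⟨t, ht⟩
  refine ⟨0, ?_⟩
  rintro _ ⟨w, rfl⟩
  exact Real.sqrt_nonneg _

/-- parent -/
lemma idx_parent (K : ℕ) {m : ℕ} (t : Torus m) : idx K t = fun i => idx (2*K) t i / 2 := by
  funext i
  simp only [idx]
  have := Nat.floor_div_natCast (((2*K:ℕ):ℝ) * rr (t i)) 2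
  rw [← this]
  congr 1
  push_cast; ring

/-- boundary cells -/
lemma bdry (K : ℕ) (hK : 0 < K) {m : ℕ} (Ω : Set (Torus m)) (C : ℝ) (hΩ : IsWellShaped Ω C) :
    (((IS m K).filter (fun k => (∃ t ∈ cell K k, t ∈ Ω) ∧ ∃ t ∈ cell K k, t ∉ Ω)).card : ℝ)
      ≤ (2 * |C| * (m+1)) * ((K:ℝ)^m / K) := by
  have hK' : (0:ℝ) < K := by exact_mod_cast hK
  obtain ⟨ho, hi⟩ := hΩ ((m+1)/K) (by positivity)
  have h1 := cells_le K hK ((IS m K).filter (fun k => (∃ t ∈ cell K k, t ∈ Ω) ∧ ∃ t ∈ cell K k, t ∉ Ω))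
    (Finset.filter_subset _ _) (outerShell Ω ((m+1)/K) ∪ innerShell Ω ((m+1)/K)) (by
      intro k hk u hu
      obtain ⟨-, ⟨s, hs, hsΩ⟩, ⟨t, ht, htΩ⟩⟩ := Finset.mem_filter.1 hk
      by_cases h : u ∈ Ω
      · right
        exact ⟨h, torusDistSet_lt K hK u t _ htΩ (hu.trans ht.symm)⟩
      · left
        exact ⟨h, torusDistSet_lt K hK u s _ hsΩ (hu.trans hs.symm)⟩)
  have h2 : tmeas (outerShell Ω ((m+1)/K) ∪ innerShell Ω ((m+1)/K))
      ≤ tmeas (outerShell Ω ((m+1)/K)) + tmeas (innerShell Ω ((m+1)/K)) := by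
    unfold tmeas
    rw [← ENNReal.toReal_add (vol_ne_top _) (vol_ne_top _)]
    exact ENNReal.toReal_mono (ENNReal.add_ne_top.2 ⟨vol_ne_top _, vol_ne_top _⟩)
      (MeasureTheory.measure_union_le _ _)
  have h3 : C * ((m+1)/K) ≤ |C| * ((m+1)/K) := by
    gcongr; exact le_abs_self C
  calc _ ≤ _ := h1
    _ ≤ (K:ℝ)^m * (2 * (|C| * ((m+1)/K))) := by gcongr; linarith
    _ = _ := by ring

/-- new cells at level 2K -/
noncomputable def TK (K : ℕ) {m : ℕ} (Ω : Set (Torus m)) : Finset (Fin m → ℕ) :=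
  (IS m (2*K)).filter (fun k => cell (2*K) k ⊆ Ω ∧ ¬ cell K (fun i => k i / 2) ⊆ Ω)

lemma TK_card (K : ℕ) (hK : 0 < K) {m : ℕ} (Ω : Set (Torus m)) (C : ℝ) (hΩ : IsWellShaped Ω C) :
    ((TK K Ω).card : ℝ) ≤ (2 * |C| * (m+1)) * (((2*K : ℕ):ℝ)^m / (2*K:ℕ)) := by
  have hK' : (0:ℝ) < K := by exact_mod_cast hK
  obtain ⟨ho, hi⟩ := hΩ ((m+1)/K) (by positivity)
  have h1 := cells_le (2*K) (by omega) (TK K Ω) (Finset.filter_subset _ _) (innerShell Ω ((m+1)/K)) (by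
      intro k hk u hu
      obtain ⟨-, h1, h2⟩ := Finset.mem_filter.1 hk
      obtain ⟨t, ht, htΩ⟩ := Set.not_subset.1 h2
      refine ⟨h1 hu, torusDistSet_lt K hK u t _ htΩ ?_⟩
      rw [idx_parent]
      have hu' : idx (2*K) u = k := hu
      rw [hu']
      exact ht.symm)
  have h3 : C * ((m+1)/K) ≤ |C| * ((m+1)/K) := by
    gcongr; exact le_abs_self C
  calc _ ≤ _ := h1
    _ ≤ ((2*K:ℕ):ℝ)^m * (|C| * ((m+1)/K)) := by gcongr; linarith
    _ = _ := by push_cast; field_simp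

end
end CWS

namespace CWS
open scoped Classical
section
variable (p : ℕ) [hp : Fact p.Prime]

noncomputable def pt {m : ℕ} (x : Fin m → ZMod p) : Torus m :=
  fun i => ((((x i).val : ℝ) / (p : ℝ) : ℝ) : AddCircle (1 : ℝ))

lemma p_posR : (0:ℝ) < p := by exact_mod_cast hp.out.pos

lemma rr_pt {m : ℕ} (x : Fin m → ZMod p) (i : Fin m) : rr (pt p x i) = (x i).val / p := by
  have := p_posR p
  refine rr_coe _ (by positivity) ?_
  rw [div_lt_one this]
  exact_mod_cast ZMod.val_lt (x i)

lemma fib_eq (K : ℕ) (hK : 0 < K) {m : ℕ} (k : Fin m → ℕ) :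
    (Finset.univ.filter fun x : Fin m → ZMod p => idx K (pt p x) = k)
      = Fintype.piFinset fun i => Jv p ((k i : ℝ)/K) (((k i : ℝ)+1)/K) := by
  have hK' : (0:ℝ) < K := by exact_mod_cast hK
  ext x
  simp only [Finset.mem_filter, Finset.mem_univ, true_and, Fintype.mem_piFinset, Jv, funext_iff, idx,
    rr_pt]
  refine forall_congr' fun i => ?_
  have := p_posR p
  rw [Nat.floor_eq_iff (by positivity), div_le_iff₀ hK', lt_div_iff₀ hK', mul_comm]

lemma idx_p {m : ℕ} (x : Fin m → ZMod p) : idx p (pt p x) = fun i => (x i).val := by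
  have := p_posR p
  funext i
  rw [idx, rr_pt, mul_div_cancel₀ _ this.ne', Nat.floor_natCast]

noncomputable def Xi {m : ℕ} (Ω : Set (Torus m)) (K : ℕ) : Finset (Fin m → ZMod p) :=
  Finset.univ.filter fun x => cell K (idx K (pt p x)) ⊆ Ω

lemma sum_fib {m : ℕ} (K : ℕ) (w : (Fin m → ZMod p) → ℝ) (T : Finset (Fin m → ℕ)) :
    ∑ x ∈ Finset.univ.filter (fun x : Fin m → ZMod p => idx K (pt p x) ∈ T), w x
      = ∑ k ∈ T, ∑ x ∈ Finset.univ.filter (fun x : Fin m → ZMod p => idx K (pt p x) = k), w x := by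
  rw [← Finset.sum_fiberwise_of_maps_to (t := T) (g := fun x => idx K (pt p x))
    (fun x hx => (Finset.mem_filter.1 hx).2)]
  refine Finset.sum_congr rfl fun k hk => Finset.sum_congr ?_ fun _ _ => rfl
  ext x
  simp only [Finset.mem_filter, Finset.mem_univ, true_and]
  constructor
  · exact fun h => h.2
  · exact fun h => ⟨h ▸ hk, h⟩

lemma Xi_step {m : ℕ} (Ω : Set (Torus m)) (K : ℕ) (hK : 0 < K) (w : (Fin m → ZMod p) → ℝ) :
    ∑ x ∈ Xi p Ω (2*K), w x = ∑ x ∈ Xi p Ω K, w x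
      + ∑ k ∈ TK K Ω, ∑ x ∈ Finset.univ.filter (fun x : Fin m → ZMod p => idx (2*K) (pt p x) = k), w x := by
  rw [← sum_fib, ← Finset.sum_union]
  · refine Finset.sum_congr ?_ fun _ _ => rfl
    ext x
    simp only [Xi, TK, Finset.mem_union, Finset.mem_filter, Finset.mem_univ, true_and]
    have hpar := idx_parent K (pt p x)
    rw [← hpar]
    constructor
    · intro h
      by_cases h2 : cell K (idx K (pt p x)) ⊆ Ω
      · exact Or.inl h2
      · exact Or.inr ⟨idx_mem _ (by omega) _, h, h2⟩
    · rintro (h | h)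
      · refine subset_trans ?_ h
        intro t ht
        have ht : idx (2*K) t = idx (2*K) (pt p x) := ht
        show idx K t = _
        rw [idx_parent, ht, ← hpar]
      · exact h.2.1
  · refine Finset.disjoint_left.2 fun x h1 h2 => ?_
    simp only [Xi, TK, Finset.mem_filter, Finset.mem_univ, true_and] at h1 h2
    rw [← idx_parent] at h2
    exact h2.2.2 h1

lemma Xi_bound {m : ℕ} (Ω : Set (Torus m)) (C : ℝ) (hΩ : IsWellShaped Ω C)
    (w : (Fin m → ZMod p) → ℝ) (B : ℝ) (hB : 0 ≤ B) (r : ℕ)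
    (hw : ∀ i ≤ r, ∀ k ∈ IS m (2^i),
      |∑ x ∈ Finset.univ.filter (fun x : Fin m → ZMod p => idx (2^i) (pt p x) = k), w x|
        * (((2^i : ℕ):ℝ)^m / (2^i:ℕ)) ≤ B) :
    ∀ i ≤ r, |∑ x ∈ Xi p Ω (2^i), w x| ≤ ((2 * |C| * (m+1)) * i + 1) * B := by
  intro i
  induction i with
  | zero =>
    intro _
    by_cases h : (Set.univ : Set (Torus m)) ⊆ Ω
    · have h0 := hw 0 (by omega) 0 (by rw [IS, Fintype.mem_piFinset]; intro i; simp)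
      simp only [pow_zero, Nat.cast_one, one_pow, div_one, mul_one] at h0
      have : Xi p Ω (2^0) = Finset.univ.filter (fun x : Fin m → ZMod p => idx 1 (pt p x) = 0) := by
        ext x
        simp only [Xi, Finset.mem_filter, Finset.mem_univ, true_and]
        constructor
        · intro _
          have := idx_mem 1 one_pos (pt p x)
          rw [IS, Fintype.mem_piFinset] at this
          funext i
          simpa using this i
        · intro _
          exact (Set.subset_univ _).trans h
      rw [this]
      simpa using h0
    · have : Xi p Ω (2^0) = ∅ := by
        rw [Finset.eq_empty_iff_forall_notMem]
        intro x hx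
        apply h
        refine subset_trans ?_ (Finset.mem_filter.1 hx).2
        intro t _
        have h1 := idx_mem 1 one_pos (pt p x)
        have h2 := idx_mem 1 one_pos t
        rw [IS, Fintype.mem_piFinset] at h1 h2
        show idx 1 t = idx 1 _
        funext i
        have a1 := h1 i
        have a2 := h2 i
        simp only [Finset.mem_range] at a1 a2
        omega
      rw [this]
      simpa using hB
  | succ i ih =>
    intro hi
    have ih := ih (by omega)
    have e : 2^(i+1) = 2 * 2^i := by ring
    have hw' := hw (i+1) hi
    rw [e] at hw' ⊢
    rw [Xi_step p Ω (2^i) (by positivity)]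
    have hT := TK_card (2^i) (by positivity) Ω C hΩ
    set Z : ℝ := (((2*2^i : ℕ):ℝ)^m / (2*2^i:ℕ)) with hZ
    have hZ0 : 0 < Z := by rw [hZ]; positivity
    have h1 : |∑ k ∈ TK (2^i) Ω, ∑ x ∈ Finset.univ.filter (fun x : Fin m → ZMod p => idx (2*2^i) (pt p x) = k), w x|
        ≤ (2 * |C| * (m+1)) * B := by
      calc _ ≤ ∑ k ∈ TK (2^i) Ω, |∑ x ∈ Finset.univ.filter (fun x : Fin m → ZMod p => idx (2*2^i) (pt p x) = k), w x| :=
            Finset.abs_sum_le_sum_abs _ _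
        _ ≤ ∑ k ∈ TK (2^i) Ω, B / Z := by
            refine Finset.sum_le_sum fun k hk => ?_
            rw [le_div_iff₀ hZ0]
            exact hw' k (Finset.filter_subset _ _ hk)
        _ = (TK (2^i) Ω).card * (B/Z) := by rw [Finset.sum_const, nsmul_eq_mul]
        _ ≤ ((2 * |C| * (m+1)) * Z) * (B/Z) := by gcongr
        _ = _ := by field_simp
    refine (abs_add_le _ _).trans ?_
    push_cast
    linarith

/-- points of Omega -/
noncomputable def XO {m : ℕ} (Ω : Set (Torus m)) : Finset (Fin m → ZMod p) :=
  Finset.univ.filter fun x => pt p x ∈ Ω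

noncomputable def BD {m : ℕ} (Ω : Set (Torus m)) (K : ℕ) : Finset (Fin m → ℕ) :=
  (IS m K).filter (fun k => (∃ t ∈ cell K k, t ∈ Ω) ∧ ∃ t ∈ cell K k, t ∉ Ω)

lemma fib_card (K : ℕ) (hK : 0 < K) (hKp : K ≤ p) {m : ℕ} (k : Fin m → ℕ) (hk : k ∈ IS m K) (i : Fin m) :
    ((Jv p ((k i : ℝ)/K) (((k i : ℝ)+1)/K)).card : ℝ) ≤ 2 * p / K := by
  have hK' : (0:ℝ) < K := by exact_mod_cast hK
  rw [IS, Fintype.mem_piFinset] at hk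
  have h1 : (k i : ℝ) + 1 ≤ K := by exact_mod_cast Finset.mem_range.1 (hk i)
  have := card_Jv p ((k i : ℝ)/K) (((k i : ℝ)+1)/K) (by positivity)
    (by gcongr; linarith) (by rw [div_le_one hK']; exact h1)
  have h2 := (abs_le.1 this).2
  have h3 : (1:ℝ) ≤ p / K := by
    rw [le_div_iff₀ hK', one_mul]; exact_mod_cast hKp
  have h4 : (((k i : ℝ)+1)/K - (k i : ℝ)/K) * p = p / K := by ring
  have h5 : 2 * (p:ℝ) / K = p/K + p/K := by ring
  linarith

lemma leftover {m : ℕ} (Ω : Set (Torus m)) (C : ℝ) (hΩ : IsWellShaped Ω C)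
    (w : (Fin m → ZMod p) → ℝ) (hw1 : ∀ x, |w x| ≤ 1) (K : ℕ) (hK : 0 < K) (hKp : K ≤ p) :
    |∑ x ∈ XO p Ω, w x| ≤ |∑ x ∈ Xi p Ω K, w x| + (2 * |C| * (m+1)) * ((2*p)^m / K) := by
  have hK' : (0:ℝ) < K := by exact_mod_cast hK
  have hsub : Xi p Ω K ⊆ XO p Ω := by
    intro x hx
    have h := (Finset.mem_filter.1 hx).2
    exact Finset.mem_filter.2 ⟨Finset.mem_univ _, h rfl⟩
  rw [← Finset.sum_sdiff hsub, add_comm]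
  refine (abs_add_le _ _).trans ?_
  gcongr
  have hb := bdry K hK Ω C hΩ
  calc _ ≤ ∑ x ∈ XO p Ω \ Xi p Ω K, |w x| := Finset.abs_sum_le_sum_abs _ _
    _ ≤ ∑ x ∈ Finset.univ.filter (fun x : Fin m → ZMod p => idx K (pt p x) ∈ BD Ω K), (1:ℝ) := by
        refine (Finset.sum_le_sum fun x _ => hw1 x).trans ?_
        refine Finset.sum_le_sum_of_subset_of_nonneg ?_ (fun _ _ _ => zero_le_one)
        intro x hx
        simp only [XO, Xi, BD, Finset.mem_sdiff, Finset.mem_filter, Finset.mem_univ, true_and] at hx ⊢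
        obtain ⟨t, ht, ht2⟩ := Set.not_subset.1 hx.2
        exact ⟨idx_mem K hK _, ⟨pt p x, rfl, hx.1⟩, ⟨t, ht, ht2⟩⟩
    _ = ∑ k ∈ BD Ω K, ((Finset.univ.filter (fun x : Fin m → ZMod p => idx K (pt p x) = k)).card : ℝ) := by
        rw [sum_fib]
        simp
    _ ≤ ∑ k ∈ BD Ω K, (2*p/K : ℝ)^m := by
        refine Finset.sum_le_sum fun k hk => ?_
        rw [fib_eq p K hK k]
        exact card_box_le _ _ (fun i => fib_card p K hK hKp k (Finset.filter_subset _ _ hk) i)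
    _ = (BD Ω K).card * (2*p/K : ℝ)^m := by rw [Finset.sum_const, nsmul_eq_mul]
    _ ≤ ((2 * |C| * (m+1)) * ((K:ℝ)^m / K)) * (2*p/K : ℝ)^m := by
        gcongr
        exact hb
    _ = _ := by rw [div_pow]; field_simp

lemma XO_card {m : ℕ} (Ω : Set (Torus m)) (C : ℝ) (hΩ : IsWellShaped Ω C) :
    |((XO p Ω).card : ℝ) - tmeas Ω * p^m| ≤ (2 * |C| * (m+1)) * ((p:ℝ)^m / p) := by
  have hp0 := hp.out.pos
  have hb := bdry p hp0 Ω C hΩ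
  change ((BD Ω p).card : ℝ) ≤ _ at hb
  set A : Finset (Fin m → ℕ) := (IS m p).filter (fun k => cell p k ⊆ Ω)
  set M : Finset (Fin m → ℕ) := (IS m p).filter (fun k => ∃ t ∈ cell p k, t ∈ Ω)
  set I : Finset (Fin m → ℕ) := (XO p Ω).image (fun x => idx p (pt p x)) with hI
  have hIc : I.card = (XO p Ω).card := by
    apply Finset.card_image_of_injective
    intro x y h
    simp only [idx_p] at h
    funext i
    exact ZMod.val_injective p (congrFun h i)
  have hIM : I ⊆ M := by
    intro k hk
    obtain ⟨x, hx, rfl⟩ := Finset.mem_image.1 hk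
    exact Finset.mem_filter.2 ⟨idx_mem p hp0 _, pt p x, rfl, (Finset.mem_filter.1 hx).2⟩
  have hAI : A ⊆ I := by
    intro k hk
    obtain ⟨h1, h2⟩ := Finset.mem_filter.1 hk
    rw [IS, Fintype.mem_piFinset] at h1
    have hid : idx p (pt p (fun i => ((k i : ℕ) : ZMod p))) = k := by
      rw [idx_p]
      funext i
      exact ZMod.val_cast_of_lt (Finset.mem_range.1 (h1 i))
    refine Finset.mem_image.2 ⟨fun i => ((k i : ℕ) : ZMod p), ?_, hid⟩
    exact Finset.mem_filter.2 ⟨Finset.mem_univ _, h2 hid⟩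
  have hMA : M ⊆ A ∪ BD Ω p := by
    intro k hk
    obtain ⟨h1, h2⟩ := Finset.mem_filter.1 hk
    rw [Finset.mem_union]
    by_cases h : cell p k ⊆ Ω
    · exact Or.inl (Finset.mem_filter.2 ⟨h1, h⟩)
    · obtain ⟨t, ht, ht2⟩ := Set.not_subset.1 h
      exact Or.inr (Finset.mem_filter.2 ⟨h1, h2, t, ht, ht2⟩)
  have c1 : (M.card : ℝ) ≤ A.card + (BD Ω p).card := by
    exact_mod_cast (Finset.card_le_card hMA).trans (Finset.card_union_le _ _)
  have c2 : (I.card : ℝ) ≤ M.card := by exact_mod_cast Finset.card_le_card hIM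
  have c3 : (A.card : ℝ) ≤ I.card := by exact_mod_cast Finset.card_le_card hAI
  have c4 := cells_le p hp0 A (Finset.filter_subset _ _) Ω (fun k hk => (Finset.mem_filter.1 hk).2)
  have c5 := le_cells p hp0 M (Finset.filter_subset _ _) Ω (fun t ht =>
    Finset.mem_filter.2 ⟨idx_mem p hp0 _, t, rfl, ht⟩)
  rw [hIc] at c2 c3
  rw [abs_le]
  constructor <;> linarith

end
end CWS

namespace CWS
open scoped Classical
section
variable (p : ℕ) [hp : Fact p.Prime]

noncomputable def ww {m n : ℕ} (G : Fin n → MvPolynomial (Fin m) (ZMod p)) (α β : Fin n → ℝ)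
    (x : Fin m → ZMod p) : ℝ :=
  (if ∀ j, MvPolynomial.eval x (G j) ∈ Jv p (α j) (β j) then 1 else 0) - ∏ j, (β j - α j)

lemma sum_ww {m n : ℕ} (G : Fin n → MvPolynomial (Fin m) (ZMod p)) (α β : Fin n → ℝ)
    (S : Finset (Fin m → ZMod p)) : ∑ x ∈ S, ww p G α β x
      = ((S.filter (fun x => ∀ j, MvPolynomial.eval x (G j) ∈ Jv p (α j) (β j))).card : ℝ)
        - (∏ j, (β j - α j)) * S.card := by
  simp only [ww, Finset.sum_sub_distrib, Finset.sum_boole, Finset.sum_const, nsmul_eq_mul]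
  ring

lemma lam_mem {n : ℕ} (α β : Fin n → ℝ) (h : ∀ j, 0 ≤ α j ∧ α j ≤ β j ∧ β j ≤ 1) :
    0 ≤ ∏ j, (β j - α j) ∧ ∏ j, (β j - α j) ≤ 1 := by
  constructor
  · exact Finset.prod_nonneg fun j _ => by linarith [(h j).2.1]
  · exact Finset.prod_le_one (fun j _ => by linarith [(h j).2.1])
      (fun j _ => by linarith [(h j).1, (h j).2.2])

lemma ww_abs {m n : ℕ} (G : Fin n → MvPolynomial (Fin m) (ZMod p)) (α β : Fin n → ℝ)
    (h : ∀ j, 0 ≤ α j ∧ α j ≤ β j ∧ β j ≤ 1) (x : Fin m → ZMod p) : |ww p G α β x| ≤ 1 := by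
  have := lam_mem α β h
  unfold ww
  rw [abs_le]
  split_ifs <;> constructor <;> linarith [this.1, this.2]

lemma log_ge : (1/2 : ℝ) ≤ Real.log p := by
  have h1 : Real.log 2 ≤ Real.log p := Real.log_le_log (by norm_num) (by exact_mod_cast hp.out.two_le)
  linarith [Real.log_two_gt_d9]

lemma main_large {m n d : ℕ} (C : ℝ) (hdp : d < p)
    (G : Fin n → MvPolynomial (Fin m) (ZMod p)) (hG : ∀ j, (G j).totalDegree ≤ d)
    (hG2 : ∀ a : Fin n → ZMod p, a ≠ 0 → 2 ≤ (∑ j, a j • G j).totalDegree)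
    (Ω : Set (Torus m)) (hΩ : IsWellShaped Ω C) (α β : Fin n → ℝ)
    (hαβ : ∀ j, 0 ≤ α j ∧ α j ≤ β j ∧ β j ≤ 1) :
    |∑ x ∈ XO p Ω, ww p G α β x| ≤
      ((2 * |C| * (m+1)) * (d*m+2*n) + (d*m+2*n) + 4 * (2 * |C| * (m+1)))
        * ((2*p : ℝ)^m/(2*p) * √p * (4 * Real.log p)^(n+2)) := by
  have hp0 := p_posR p
  have hs0 : 0 < √(p:ℝ) := Real.sqrt_pos.2 hp0
  have hss : √(p:ℝ) * √p = p := Real.mul_self_sqrt hp0.le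
  have hp1 : (1:ℝ) ≤ p := by exact_mod_cast hp.out.one_lt.le
  have hs1 : 1 ≤ √(p:ℝ) := by rw [Real.one_le_sqrt]; exact hp1
  have hlog := log_ge p
  set L := 4 * Real.log p with hL
  have hL1 : 1 ≤ L := by linarith
  obtain ⟨r, hr1, hr2⟩ := exists_nat_pow_near hs1 (one_lt_two : (1:ℝ) < 2)
  have hrL : (r:ℝ) ≤ L := by
    have h1 := Real.log_le_log (by positivity) hr1
    rw [Real.log_pow, Real.log_sqrt hp0.le] at h1
    have : (r:ℝ) * (1/2) ≤ r * Real.log 2 := by gcongr; linarith [Real.log_two_gt_d9]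
    linarith
  set c1 : ℝ := d*m+2*n with hc1
  set C1 : ℝ := 2 * |C| * (m+1) with hC1
  have hC10 : 0 ≤ C1 := by positivity
  have hc10 : 0 ≤ c1 := by positivity
  set Q : ℝ := (2*p : ℝ)^m/(2*p) with hQ
  have hQ0 : 0 < Q := by positivity
  set B : ℝ := c1 * Q * √p * L^(n+1) with hB
  have hB0 : 0 ≤ B := by positivity
  have hK : ∀ i ≤ r, ((2^i:ℕ):ℝ) ≤ √p := by
    intro i hi
    push_cast
    exact (pow_le_pow_right₀ one_le_two hi).trans hr1
  have hKp : ∀ i ≤ r, 2^i ≤ p := by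
    intro i hi
    have : ((2^i:ℕ):ℝ) ≤ p := (hK i hi).trans (by nlinarith)
    exact_mod_cast this
  have hw : ∀ i ≤ r, ∀ k ∈ IS m (2^i),
      |∑ x ∈ Finset.univ.filter (fun x : Fin m → ZMod p => idx (2^i) (pt p x) = k), ww p G α β x|
        * (((2^i : ℕ):ℝ)^m / (2^i:ℕ)) ≤ B := by
    intro i hi k hk
    have hKi := hK i hi
    have hKpi := hKp i hi
    have hKpos : 0 < 2^i := by positivity
    generalize 2^i = K at *
    have hK' : (0:ℝ) < K := by exact_mod_cast hKpos
    have hK1 : (1:ℝ) ≤ K := by exact_mod_cast hKpos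
    rw [fib_eq p K hKpos, sum_ww]
    have hk' := hk
    rw [IS, Fintype.mem_piFinset] at hk'
    have hb := box_equi p hdp G hG hG2 (2*p/K) L
      (by rw [le_div_iff₀ hK']; nlinarith)
      (by rw [div_le_iff₀ hK']; nlinarith) hL1 le_rfl
      (fun i => (k i : ℝ)/K) (fun i => ((k i : ℝ)+1)/K)
      (fun i => ⟨by gcongr; linarith, by
        rw [div_le_one hK']; exact_mod_cast Finset.mem_range.1 (hk' i)⟩)
      (fun i => fib_card p K hKpos hKpi k hk i) α β hαβ
    have hb2 : |(((Fintype.piFinset fun i => Jv p ((k i : ℝ)/K) (((k i : ℝ)+1)/K)).filter (fun x => ∀ j, MvPolynomial.eval x (G j) ∈ Jv p (α j) (β j))).card:ℝ) - (∏ j, (β j - α j)) * (Fintype.piFinset fun i => Jv p ((k i : ℝ)/K) (((k i : ℝ)+1)/K)).card| * (2*p/K) ≤ c1 * (2*p/K)^m * √p * L^(n+1) :=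
      le_trans (le_of_eq (by congr!)) hb
    set V := |(((Fintype.piFinset fun i => Jv p ((k i : ℝ)/K) (((k i : ℝ)+1)/K)).filter (fun x => ∀ j, MvPolynomial.eval x (G j) ∈ Jv p (α j) (β j))).card:ℝ) - (∏ j, (β j - α j)) * (Fintype.piFinset fun i => Jv p ((k i : ℝ)/K) (((k i : ℝ)+1)/K)).card|
    have e1 : V * ((K:ℝ)^m/K) = (V * (2*p/K)) * ((K:ℝ)^m / (2*p)) := by field_simp
    have e2 : B = (c1 * (2*p/K)^m * √p * L^(n+1)) * ((K:ℝ)^m / (2*p)) := by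
      rw [hB, hQ, div_pow]; field_simp
    rw [e1, e2]
    gcongr
  have h1 := Xi_bound p Ω C hΩ (ww p G α β) B hB0 r hw r le_rfl
  have h2 := leftover p Ω C hΩ (ww p G α β) (ww_abs p G α β hαβ) (2^r) (by positivity) (hKp r le_rfl)
  rw [← hC1] at h1 h2
  have h3 : (2*p : ℝ)^m / ((2^r:ℕ):ℝ) ≤ 4 * (Q * √p) := by
    push_cast
    rw [div_le_iff₀ (by positivity)]
    have e : (2*p : ℝ)^m = Q * (2 * (√p * √p)) := by rw [hss, hQ]; field_simp
    rw [e]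
    have : √(p:ℝ) ≤ 2 * 2^r := by rw [pow_succ] at hr2; linarith
    calc Q * (2 * (√p * √p)) ≤ Q * (2 * (√p * (2 * 2^r))) := by gcongr
      _ = _ := by ring
  have hLn : 1 ≤ L^(n+2) := one_le_pow₀ hL1
  have hLn1 : L^(n+1) ≤ L^(n+2) := pow_le_pow_right₀ hL1 (by omega)
  have h4 : (C1 * r + 1) * B ≤ (C1 * c1 + c1) * (Q * √p * L^(n+2)) := by
    have a1 : C1 * r * B ≤ C1 * L * B := by gcongr
    have a2 : C1 * L * B = C1 * c1 * (Q * √p * L^(n+2)) := by rw [hB]; ring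
    have a3 : B ≤ c1 * (Q * √p * L^(n+2)) := by
      rw [hB, mul_assoc, mul_assoc c1, ← mul_assoc Q]; gcongr
    linarith
  have h5 : C1 * ((2*p : ℝ)^m / ((2^r:ℕ):ℝ)) ≤ 4 * C1 * (Q * √p * L^(n+2)) := by
    have : Q * √p ≤ Q * √p * L^(n+2) := le_mul_of_one_le_right (by positivity) hLn
    calc _ ≤ C1 * (4 * (Q * √p * L^(n+2))) := by gcongr; linarith
      _ = _ := by ring
  linarith

lemma main_fin {m n d : ℕ} (hm : 0 < m) (C : ℝ)
    (G : Fin n → MvPolynomial (Fin m) (ZMod p)) (hG : ∀ j, (G j).totalDegree ≤ d)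
    (hG2 : ∀ a : Fin n → ZMod p, a ≠ 0 → 2 ≤ (∑ j, a j • G j).totalDegree)
    (Ω : Set (Torus m)) (hΩ : IsWellShaped Ω C) (α β : Fin n → ℝ)
    (hαβ : ∀ j, 0 ≤ α j ∧ α j ≤ β j ∧ β j ≤ 1) :
    |(((XO p Ω).filter (fun x => ∀ j, MvPolynomial.eval x (G j) ∈ Jv p (α j) (β j))).card : ℝ)
        - (∏ j, (β j - α j)) * tmeas Ω * (p:ℝ)^m| ≤
      (2^m * 4^(n+2) * ((2 * |C| * (m+1)) * (d*m+2*n) + (d*m+2*n) + 5 * (2 * |C| * (m+1)) + d + 1))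
        * ((p : ℝ)^m/p * √p) * Real.log p^(n+2) := by
  have hp0 := p_posR p
  have hs0 : 0 < √(p:ℝ) := Real.sqrt_pos.2 hp0
  have hss : √(p:ℝ) * √p = p := Real.mul_self_sqrt hp0.le
  have hp1 : (1:ℝ) ≤ p := by exact_mod_cast hp.out.one_lt.le
  have hs1 : 1 ≤ √(p:ℝ) := by rw [Real.one_le_sqrt]; exact hp1
  have hlog := log_ge p
  have hlam := lam_mem α β hαβ
  have hXO := XO_card p Ω C hΩ
  have hsum := sum_ww p G α β (XO p Ω)
  set lam := ∏ j, (β j - α j)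
  set c1 : ℝ := d*m+2*n with hc1
  set C1 : ℝ := 2 * |C| * (m+1) with hC1
  have hC10 : 0 ≤ C1 := by positivity
  have hc10 : 0 ≤ c1 := by positivity
  set N := (((XO p Ω).filter (fun x => ∀ j, MvPolynomial.eval x (G j) ∈ Jv p (α j) (β j))).card : ℝ) with hN
  set Q : ℝ := (p : ℝ)^m/p * √p with hQ
  have hQ0 : 0 < Q := by positivity
  set L := (4 * Real.log p)^(n+2) with hL
  have hL1 : 1 ≤ L := one_le_pow₀ (by linarith)
  have e : (2^m * 4^(n+2) * (C1 * c1 + c1 + 5 * C1 + d + 1)) * Q * Real.log p^(n+2)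
      = (C1 * c1 + c1 + 5 * C1 + d + 1) * (2^m * (Q * L)) := by
    rw [hL, mul_pow]; ring
  rw [e]
  have hQL : Q ≤ Q * L := le_mul_of_one_le_right hQ0.le hL1
  have h2m : (1:ℝ) ≤ 2^m := one_le_pow₀ one_le_two
  have hQL2 : Q * L ≤ 2^m * (Q * L) := le_mul_of_one_le_left (by positivity) h2m
  have hd0 : (0:ℝ) ≤ d := by positivity
  by_cases hdp : d < p
  · have h1 := main_large p C hdp G hG hG2 Ω hΩ α β hαβ
    rw [hsum, ← hc1, ← hC1, ← hL] at h1
    have h2 : (2*p : ℝ)^m/(2*p) * √p * L ≤ 2^m * (Q * L) := by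
      have : (2*p : ℝ)^m/(2*p) * √p * L = 2^m * (Q * L) / 2 := by
        rw [hQ, mul_pow]; field_simp
      rw [this]
      have : 0 ≤ 2^m * (Q * L) := by positivity
      linarith
    have h3 : (p:ℝ)^m / p ≤ Q := le_mul_of_one_le_right (by positivity) hs1
    have h4 : |lam * ((XO p Ω).card - tmeas Ω * p^m)| ≤ C1 * (2^m * (Q*L)) := by
      rw [abs_mul, abs_of_nonneg hlam.1]
      calc _ ≤ 1 * (C1 * ((p:ℝ)^m / p)) := by gcongr; exact hlam.2
        _ ≤ _ := by rw [one_mul]; gcongr; linarith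
    have h5 : N - lam * tmeas Ω * (p:ℝ)^m = (N - lam * (XO p Ω).card) + lam * ((XO p Ω).card - tmeas Ω * p^m) := by
      ring
    rw [h5]
    refine (abs_add_le _ _).trans ?_
    have h6 : (C1 * c1 + c1 + 4 * C1) * ((2*p : ℝ)^m/(2*p) * √p * L) ≤ (C1 * c1 + c1 + 4 * C1) * (2^m * (Q * L)) := by
      gcongr
    have h7 : 0 ≤ (d + 1) * (2^m * (Q*L)) := by positivity
    linarith
  · have hpd : (p:ℝ) ≤ d := by exact_mod_cast not_lt.1 hdp
    have h1 : |N - lam * tmeas Ω * (p:ℝ)^m| ≤ (p:ℝ)^m := by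
      have a1 : N ≤ (p:ℝ)^m := by
        have := Finset.card_le_univ ((XO p Ω).filter (fun x => ∀ j, MvPolynomial.eval x (G j) ∈ Jv p (α j) (β j)))
        simp only [Fintype.card_pi, ZMod.card, Finset.prod_const, Finset.card_univ, Fintype.card_fin] at this
        rw [hN]
        exact_mod_cast this
      have a2 : 0 ≤ N := by positivity
      have a3 : lam * tmeas Ω * (p:ℝ)^m ≤ 1 * 1 * (p:ℝ)^m := by
        gcongr
        · exact tmeas_nonneg _
        · exact hlam.2
        · exact tmeas_le_one _
      have a4 : 0 ≤ lam * tmeas Ω * (p:ℝ)^m :=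
        mul_nonneg (mul_nonneg hlam.1 (tmeas_nonneg _)) (by positivity)
      rw [abs_le]; constructor <;> linarith
    have h2 : (p:ℝ)^m ≤ d * Q := by
      calc (p:ℝ)^m = p * ((p:ℝ)^m/p * 1) := by field_simp
        _ ≤ d * Q := by rw [hQ]; gcongr
    have h3 : d * Q ≤ d * (2^m * (Q*L)) := by gcongr; linarith
    have h4 : 0 ≤ (C1 * c1 + c1 + 5 * C1 + 1) * (2^m * (Q*L)) := by positivity
    linarith

end
end CWS

/-- Counting formula for well shaped sets: for a well shaped `Ω ⊆ 𝕋_m` with constant `C`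
and a box `Π = ∏_j [α_j, β_j) ⊆ 𝕋_n`, the number `N(Ω;Π)` of `x ∈ {0,…,p−1}^m` with
`x/p ∈ Ω` and `({G_1(x)/p},…,{G_n(x)/p}) ∈ Π` satisfies
`|N(Ω;Π) − λ(Π) μ(Ω) p^m| ≤ c p^{m−1/2} (log p)^{n+2}` with `c = c(m,n,d,C)`. -/
theorem counting_well_shaped (m n d : ℕ) (hm : 0 < m) (hn : 0 < n) (C : ℝ) :
    ∃ c : ℝ, 0 < c ∧
      ∀ p : ℕ, p.Prime →
        ∀ G : Fin n → MvPolynomial (Fin m) (ZMod p),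
          (∀ j, (G j).totalDegree ≤ d) →
          Degree2Independent G →
          ∀ Ω : Set (Torus m), IsWellShaped Ω C →
            ∀ α β : Fin n → ℝ, (∀ j, 0 ≤ α j ∧ α j ≤ β j ∧ β j ≤ 1) →
              |({x : Fin m → Fin p | torusPt p x ∈ Ω ∧
                    ∀ j, α j ≤ fracPt G (fun i => ((x i : ℕ) : ℤ)) j ∧
                      fracPt G (fun i => ((x i : ℕ) : ℤ)) j < β j}.ncard : ℝ)
                  - (∏ j, (β j - α j)) * tmeas Ω * (p : ℝ) ^ m|
                ≤ c * (p : ℝ) ^ ((m : ℝ) - 1 / 2) * Real.log p ^ (n + 2) := by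
  classical
  refine ⟨2^m * 4^(n+2) * ((2 * |C| * (m+1)) * (d*m+2*n) + (d*m+2*n) + 5 * (2 * |C| * (m+1)) + d + 1),
    by positivity, ?_⟩
  intro p hp G hG hG2 Ω hΩ α β hαβ
  haveI : Fact p.Prime := ⟨hp⟩
  have hp0 := CWS.p_posR p
  have h := CWS.main_fin p hm C G hG hG2 Ω hΩ α β hαβ
  have e1 : (p : ℝ) ^ ((m : ℝ) - 1 / 2) = (p : ℝ)^m/p * √p := by
    have : (m:ℝ) - 1/2 = (m:ℝ) - 1 + 1/2 := by ring
    rw [this, Real.rpow_add hp0, Real.rpow_sub hp0, Real.rpow_natCast, Real.rpow_one, Real.sqrt_eq_rpow]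
  rw [e1]
  have e2 : {x : Fin m → Fin p | torusPt p x ∈ Ω ∧
                    ∀ j, α j ≤ fracPt G (fun i => ((x i : ℕ) : ℤ)) j ∧
                      fracPt G (fun i => ((x i : ℕ) : ℤ)) j < β j}.ncard
      = ((CWS.XO p Ω).filter (fun x => ∀ j, MvPolynomial.eval x (G j) ∈ CWS.Jv p (α j) (β j))).card := by
    rw [← Set.ncard_coe_finset]
    have hval : ∀ a : Fin p, (((a : ℕ) : ZMod p)).val = (a : ℕ) := fun a => ZMod.val_cast_of_lt a.2
    have hcond : ∀ x : Fin m → Fin p,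
        ((fun i => ((x i : ℕ) : ZMod p)) ∈ ((CWS.XO p Ω).filter (fun x => ∀ j, MvPolynomial.eval x (G j) ∈ CWS.Jv p (α j) (β j)))) ↔
        (torusPt p x ∈ Ω ∧ ∀ j, α j ≤ fracPt G (fun i => ((x i : ℕ) : ℤ)) j ∧
                      fracPt G (fun i => ((x i : ℕ) : ℤ)) j < β j) := by
      intro x
      have hpt : (CWS.pt p fun i => ((x i : ℕ) : ZMod p)) = torusPt p x := by
        funext i
        simp only [CWS.pt, torusPt, hval]
      simp only [CWS.XO, CWS.Jv, hpt, Finset.mem_filter, Finset.mem_univ, true_and,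
        fracPt, Int.cast_natCast]
    refine Set.ncard_congr (fun x _ => fun i => ((x i : ℕ) : ZMod p)) ?_ ?_ ?_
    · intro x hx
      exact Finset.mem_coe.2 ((hcond x).2 hx)
    · intro x y _ _ hxy
      funext i
      have := congrArg ZMod.val (congrFun hxy i)
      simp only [hval] at this
      exact Fin.ext this
    · intro y hy
      have hy' : (fun i => (((⟨(y i).val, ZMod.val_lt (y i)⟩ : Fin p) : ℕ) : ZMod p)) = y := by
        funext i
        simp
      refine ⟨fun i => ⟨(y i).val, ZMod.val_lt (y i)⟩, ?_, hy'⟩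
      rw [Set.mem_setOf_eq, ← hcond, hy']
      exact Finset.mem_coe.1 hy
  rw [e2]
  exact le_trans (le_of_eq (by congr!)) h
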